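/- For every set K ⊆ {2,3,4,...} of block sizes and every positive integer d, there exist a constant f (depending only on d and K) and a threshold v₀ such that for every admissible integer v ≥ v₀ there exists a pairwise balanced design PBD(v,K) in which every set of d points is contained in a flat of size at most f. -/

import Mathlib

/-- `IsPBD V K Blocks` : the blocks form a pairwise balanced design on point set `V`
with block sizes in `K`: every block is a subset of `V` of size in `K`, and every
pair of distinct points of `V` lies in exactly one block. -/
def IsPBD {X : Type*} (V : Finset X) (K : Set ℕ) (Blocks : Finset (Finset X)) : Prop :=
  (∀ B ∈ Blocks, B ⊆ V ∧ B.card ∈ K) ∧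
    ∀ x ∈ V, ∀ y ∈ V, x ≠ y → ∃! B, B ∈ Blocks ∧ x ∈ B ∧ y ∈ B

/-- `IsFlat V Blocks Y` : `Y` is a flat of the design `(V, Blocks)`: `Y ⊆ V` and every
pair of distinct points of `Y` lies in a block entirely contained in `Y`. -/
def IsFlat {X : Type*} (V : Finset X) (Blocks : Finset (Finset X)) (Y : Finset X) : Prop :=
  Y ⊆ V ∧ ∀ x ∈ Y, ∀ y ∈ Y, x ≠ y → ∃ B ∈ Blocks, x ∈ B ∧ y ∈ B ∧ B ⊆ Y

/-- `SetGcdDvd S m` : the gcd of the set `S ⊆ ℤ` divides `m`; equivalently, `m` lies in the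
additive subgroup of `ℤ` generated by `S`. -/
def SetGcdDvd (S : Set ℤ) (m : ℤ) : Prop := m ∈ AddSubgroup.closure S

/-- `v` is admissible for the set of block sizes `K` :
`α(K) = gcd {k-1 : k ∈ K}` divides `v-1` and `β(K) = gcd {k(k-1) : k ∈ K}` divides `v(v-1)`. -/
def Admissible (K : Set ℕ) (v : ℕ) : Prop :=
  SetGcdDvd ((fun k : ℕ => (k : ℤ) - 1) '' K) ((v : ℤ) - 1) ∧
    SetGcdDvd ((fun k : ℕ => (k : ℤ) * ((k : ℤ) - 1)) '' K) ((v : ℤ) * ((v : ℤ) - 1))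

/-- `𝓑` is a decomposition of the graph `G` into cliques with sizes in `K`. -/
def IsDec {X : Type*} (K : Set ℕ) (G : SimpleGraph X) (𝓑 : Set (Finset X)) : Prop :=
  (∀ B ∈ 𝓑, B.card ∈ K ∧ ∀ x ∈ B, ∀ y ∈ B, x ≠ y → G.Adj x y) ∧
    ∀ x y, G.Adj x y → ∃! B, B ∈ 𝓑 ∧ x ∈ B ∧ y ∈ B

/-- `G` can be decomposed into cliques with sizes in `K`. -/
def Dec {X : Type*} (K : Set ℕ) (G : SimpleGraph X) : Prop := ∃ 𝓑, IsDec K G 𝓑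

/-- The complete multipartite graph on `X` whose parts are the fibres of `π`. -/
abbrev multipartite {X I : Type*} (π : X → I) : SimpleGraph X := (⊤ : SimpleGraph I).comap π

theorem multipartite_adj {X I : Type*} (π : X → I) (x y : X) :
    (multipartite π).Adj x y ↔ π x ≠ π y := by
  simp [multipartite]

theorem IsDec.glue {K : Set ℕ} {X ι : Type*} {Z : ι → Type*} {G : SimpleGraph X}
    {H : ∀ i, SimpleGraph (Z i)} {𝓒 : ∀ i, Set (Finset (Z i))} (hC : ∀ i, IsDec K (H i) (𝓒 i))
    (φ : ∀ i, Z i ↪ X) (hle : ∀ i z z', (H i).Adj z z' → G.Adj (φ i z) (φ i z'))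
    (hcov : ∀ x y, G.Adj x y → ∃ i z z', (H i).Adj z z' ∧ φ i z = x ∧ φ i z' = y)
    (hdisj : ∀ i j z z' w w', (H i).Adj z z' → (H j).Adj w w' → φ i z = φ j w →
      φ i z' = φ j w' → i = j) :
    IsDec K G {B | ∃ i, ∃ C ∈ 𝓒 i, B = C.map (φ i)} := by
  refine ⟨?_, ?_⟩
  · rintro B ⟨i, C, hCi, rfl⟩
    refine ⟨by simpa using ((hC i).1 C hCi).1, ?_⟩
    intro x hx y hy hxy
    simp only [Finset.mem_map] at hx hy
    obtain ⟨z, hz, rfl⟩ := hx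
    obtain ⟨z', hz', rfl⟩ := hy
    exact hle i z z' (((hC i).1 C hCi).2 z hz z' hz' (fun h => hxy (by rw [h])))
  · intro x y hxy
    obtain ⟨i, z, z', hzz, rfl, rfl⟩ := hcov x y hxy
    obtain ⟨C, ⟨hCi, hz, hz'⟩, hu⟩ := (hC i).2 z z' hzz
    refine ⟨C.map (φ i), ⟨⟨i, C, hCi, rfl⟩, ?_, ?_⟩, ?_⟩
    · exact Finset.mem_map_of_mem _ hz
    · exact Finset.mem_map_of_mem _ hz'
    · rintro B ⟨⟨j, C', hC', rfl⟩, hx, hy⟩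
      simp only [Finset.mem_map] at hx hy
      obtain ⟨w, hw, hw1⟩ := hx
      obtain ⟨w', hw', hw1'⟩ := hy
      have hne : w ≠ w' := by
        rintro rfl
        exact hxy.ne (hw1.symm.trans hw1')
      have hww := ((hC j).1 C' hC').2 w hw w' hw' hne
      obtain rfl := hdisj i j z z' w w' hzz hww hw1.symm hw1'.symm
      obtain rfl := (φ i).injective hw1
      obtain rfl := (φ i).injective hw1'
      rw [hu C' ⟨hC', hw, hw'⟩]

theorem Dec.glue {K : Set ℕ} {X ι : Type*} {Z : ι → Type*} {G : SimpleGraph X}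
    {H : ∀ i, SimpleGraph (Z i)} (hC : ∀ i, Dec K (H i))
    (φ : ∀ i, Z i → X) (hφ : ∀ i, Function.Injective (φ i))
    (hle : ∀ i z z', (H i).Adj z z' → G.Adj (φ i z) (φ i z'))
    (hcov : ∀ x y, G.Adj x y → ∃ i z z', (H i).Adj z z' ∧ φ i z = x ∧ φ i z' = y)
    (hdisj : ∀ i j z z' w w', (H i).Adj z z' → (H j).Adj w w' → φ i z = φ j w →
      φ i z' = φ j w' → i = j) : Dec K G := by
  choose 𝓒 h𝓒 using hC
  exact ⟨_, IsDec.glue h𝓒 (fun i => ⟨φ i, hφ i⟩) hle hcov hdisj⟩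

theorem Dec.mono {K L : Set ℕ} (h : K ⊆ L) {X : Type*} {G : SimpleGraph X} (hG : Dec K G) :
    Dec L G := by
  obtain ⟨𝓑, h1, h2⟩ := hG
  exact ⟨𝓑, fun B hB => ⟨h (h1 B hB).1, (h1 B hB).2⟩, h2⟩

theorem Dec.of_no_adj {K : Set ℕ} {X : Type*} {G : SimpleGraph X}
    (h : ∀ x y, ¬ G.Adj x y) : Dec K G :=
  ⟨∅, by simp, fun x y hxy => (h x y hxy).elim⟩

theorem Dec.top_of_card {K : Set ℕ} {X : Type*} [Finite X] (h : Nat.card X ∈ K) :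
    Dec K (⊤ : SimpleGraph X) := by
  have := Fintype.ofFinite X
  refine ⟨{Finset.univ}, ?_, ?_⟩
  · rintro B rfl
    refine ⟨by simpa using h, fun x _ y _ hxy => by simpa using hxy⟩
  · intro x y _
    exact ⟨Finset.univ, by simp, by simp⟩

theorem Dec.top_of_card_or {K : Set ℕ} {X : Type*} [Finite X]
    (h : Nat.card X ≤ 1 ∨ Nat.card X ∈ K) : Dec K (⊤ : SimpleGraph X) := by
  rcases h with h | h
  · apply Dec.of_no_adj
    have := (Finite.card_le_one_iff_subsingleton).1 h
    intro x y hxy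
    exact hxy.ne (Subsingleton.elim x y)
  · exact Dec.top_of_card h

theorem Dec.iso {K : Set ℕ} {X Y : Type*} {G : SimpleGraph X} {H : SimpleGraph Y}
    (hG : Dec K G) (e : X ≃ Y) (he : ∀ x y, H.Adj (e x) (e y) ↔ G.Adj x y) : Dec K H := by
  refine Dec.glue (ι := Unit) (fun _ => hG) (fun _ => e) (fun _ => e.injective)
    (fun _ x y h => (he x y).2 h) ?_ (fun _ _ _ _ _ _ _ _ _ _ => rfl)
  intro x y h
  refine ⟨(), e.symm x, e.symm y, (he _ _).1 (by simpa using h), by simp, by simp⟩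

theorem Dec.top_congr {K : Set ℕ} {X Y : Type*} [Finite X] [Finite Y]
    (h : Nat.card X = Nat.card Y) (hX : Dec K (⊤ : SimpleGraph X)) :
    Dec K (⊤ : SimpleGraph Y) :=
  hX.iso (Finite.card_eq.1 h).some (fun x y => by simp)

/-- Replacing every block by a decomposition of a complete graph. -/
theorem Dec.refine {K L : Set ℕ} {X : Type*} {G : SimpleGraph X} (hG : Dec L G)
    (hL : ∀ l ∈ L, Dec K (⊤ : SimpleGraph (Fin l))) : Dec K G := by
  obtain ⟨𝓑, h1, h2⟩ := hG
  refine Dec.glue (ι := 𝓑) (Z := fun B => B.1) (H := fun _ => ⊤) ?_ (fun B => Subtype.val)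
    (fun B => Subtype.val_injective) ?_ ?_ ?_
  · intro B
    exact Dec.top_congr (by simp) (hL _ (h1 B.1 B.2).1)
  · intro B z z' h
    exact (h1 B.1 B.2).2 _ z.2 _ z'.2 (fun h' => h.ne (Subtype.ext h'))
  · intro x y hxy
    obtain ⟨B, ⟨hB, hx, hy⟩, -⟩ := h2 x y hxy
    exact ⟨⟨B, hB⟩, ⟨x, hx⟩, ⟨y, hy⟩, by simpa using hxy.ne, rfl, rfl⟩
  · intro B C z z' w w' h h' e e'
    have := (h1 B.1 B.2).2 _ z.2 _ z'.2 (fun h' => h.ne (Subtype.ext h'))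
    refine Subtype.ext ((h2 _ _ this).unique ⟨B.2, z.2, z'.2⟩ ⟨C.2, ?_, ?_⟩)
    · rw [e]; exact w.2
    · rw [e']; exact w'.2

/-- Group divisible designs only depend on the sizes of the groups. -/
theorem Dec.multipartite_congr {K : Set ℕ} {X Y I J : Type*} [Finite X] [Finite Y]
    {π : X → I} {ρ : Y → J} (e : I ≃ J)
    (h : ∀ i, Nat.card {x // π x = i} = Nat.card {y // ρ y = e i})
    (hX : Dec K (multipartite π)) : Dec K (multipartite ρ) := by
  let E : X ≃ Y := (Equiv.sigmaFiberEquiv π).symm.trans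
    ((Equiv.sigmaCongr e (fun i => (Finite.card_eq.1 (h i)).some)).trans (Equiv.sigmaFiberEquiv ρ))
  have hE : ∀ x, ρ (E x) = e (π x) := by
    intro x
    exact ((Finite.card_eq.1 (h (π x))).some ⟨x, rfl⟩).2
  refine hX.iso E (fun x y => ?_)
  rw [multipartite_adj, multipartite_adj, hE, hE]
  simp

/-- Filling in the fibres of `ρ` in a design with groups the fibres of `ρ ∘ π`. -/
theorem Dec.multipartite_fill {K : Set ℕ} {X I J : Type*} {π : X → I} (ρ : I → J)
    (h : Dec K (multipartite (ρ ∘ π)))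
    (hf : ∀ j, Dec K (multipartite (fun x : {x // ρ (π x) = j} => π x))) :
    Dec K (multipartite π) := by
  refine Dec.glue (ι := Option J)
    (Z := fun o => match o with | none => X | some j => {x // ρ (π x) = j})
    (H := fun o => match o with
      | none => multipartite (ρ ∘ π)
      | some j => multipartite (fun x : {x // ρ (π x) = j} => π x))
    ?_ (fun o => match o with | none => id | some j => Subtype.val) ?_ ?_ ?_ ?_
  · rintro (_ | j)
    exacts [h, hf j]
  · rintro (_ | j)
    exacts [Function.injective_id, Subtype.val_injective]
  · rintro (_ | j) z z' hz
    · simp only [multipartite_adj, Function.comp, id] at hz ⊢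
      exact fun h => hz (by rw [h])
    · simpa using hz
  · intro x y hxy
    by_cases hr : ρ (π x) = ρ (π y)
    · exact ⟨some (ρ (π x)), ⟨x, rfl⟩, ⟨y, hr.symm⟩, by simpa using hxy, rfl, rfl⟩
    · exact ⟨none, x, y, by simpa using hr, rfl, rfl⟩
  · rintro (_ | i) (_ | j) z z' w w' hz hw e e'
    · rfl
    · simp only [id] at e e'
      subst e e'
      simp only [multipartite_adj, Function.comp, w.2, w'.2] at hz
      exact (hz rfl).elim
    · simp only [id] at e e'
      subst e e'
      simp only [multipartite_adj, Function.comp, z.2, z'.2] at hw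
      exact (hw rfl).elim
    · simp only at e
      have := z.2
      rw [e, w.2] at this
      rw [this]

/-- Filling in the groups of a group divisible design. -/
theorem Dec.fill {K : Set ℕ} {X I : Type*} {π : X → I} (h : Dec K (multipartite π))
    (hf : ∀ i, Dec K (⊤ : SimpleGraph {x // π x = i})) : Dec K (⊤ : SimpleGraph X) := by
  have := Dec.multipartite_fill (π := (id : X → X)) π h (fun j => by
    refine (hf j).iso (Equiv.refl _) (fun x y => ?_)
    simp [Subtype.ext_iff])
  refine this.iso (Equiv.refl _) (fun x y => by simp)

/-- A group divisible design with `l` groups of size `g` and blocks with sizes in `K`. -/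
def GDD (K : Set ℕ) (g l : ℕ) : Prop := Dec K (multipartite (Prod.fst : Fin l × Fin g → Fin l))

theorem card_fiber_fst {I A : Type*} (i : I) :
    Nat.card {x : I × A // x.1 = i} = Nat.card A := by
  refine Nat.card_congr ⟨fun x => x.1.2, fun a => ⟨(i, a), rfl⟩, ?_, ?_⟩
  · rintro ⟨⟨a, b⟩, rfl⟩; rfl
  · intro a; rfl

theorem GDD.dec {K : Set ℕ} {g l : ℕ} (h : GDD K g l) {X I : Type*} [Finite X] [Finite I]
    {π : X → I} (hI : Nat.card I = l) (hπ : ∀ i, Nat.card {x // π x = i} = g) :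
    Dec K (multipartite π) := by
  have e : Fin l ≃ I := (Finite.card_eq.1 (by simpa using hI.symm)).some
  refine Dec.multipartite_congr e (fun i => ?_) h
  rw [hπ, card_fiber_fst, Nat.card_fin]

theorem GDD.of_dec {K : Set ℕ} {g l : ℕ} {X I : Type*} [Finite X] [Finite I]
    {π : X → I} (hI : Nat.card I = l) (hπ : ∀ i, Nat.card {x // π x = i} = g)
    (h : Dec K (multipartite π)) : GDD K g l := by
  have e : I ≃ Fin l := (Finite.card_eq.1 (by simpa using hI)).some
  refine Dec.multipartite_congr e (fun i => ?_) h
  rw [hπ, card_fiber_fst, Nat.card_fin]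

/-- Giving uniform weight to the points of a design. -/
theorem Dec.inflate {K L : Set ℕ} {g : ℕ} (hL : ∀ l ∈ L, GDD K g l) {X : Type*}
    {G : SimpleGraph X} (hG : Dec L G) :
    Dec K (G.comap (Prod.fst : X × Fin g → X)) := by
  obtain ⟨𝓑, h1, h2⟩ := hG
  refine Dec.glue (ι := 𝓑) (Z := fun B => B.1 × Fin g) (H := fun _ => multipartite Prod.fst) ?_
    (fun B z => (z.1.1, z.2)) ?_ ?_ ?_ ?_
  · intro B
    refine (hL _ (h1 B.1 B.2).1).dec (by simp) (fun i => ?_)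
    rw [card_fiber_fst, Nat.card_fin]
  · rintro B ⟨⟨a, ha⟩, b⟩ ⟨⟨c, hc⟩, d⟩ h
    simpa using h
  · intro B z z' h
    rw [multipartite_adj] at h
    exact (h1 B.1 B.2).2 _ z.1.2 _ z'.1.2 (fun h' => h (Subtype.ext h'))
  · rintro ⟨x, a⟩ ⟨y, b⟩ hxy
    obtain ⟨B, ⟨hB, hx, hy⟩, -⟩ := h2 x y hxy
    refine ⟨⟨B, hB⟩, (⟨x, hx⟩, a), (⟨y, hy⟩, b), ?_, rfl, rfl⟩
    have : x ≠ y := G.ne_of_adj hxy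
    simpa [multipartite_adj] using this
  · intro B C z z' w w' h h' e e'
    rw [multipartite_adj] at h
    have := (h1 B.1 B.2).2 _ z.1.2 _ z'.1.2 (fun h' => h (Subtype.ext h'))
    refine Subtype.ext ((h2 _ _ this).unique ⟨B.2, z.1.2, z'.1.2⟩ ⟨C.2, ?_, ?_⟩)
    · have e1 : (z.1 : X) = w.1 := (Prod.ext_iff.1 e).1
      rw [e1]; exact w.1.2
    · have e1 : (z'.1 : X) = w'.1 := (Prod.ext_iff.1 e').1
      rw [e1]; exact w'.1.2

/-- Gluing designs on the members of a family of cliques. -/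
theorem Dec.of_cliques {K : Set ℕ} {X ι : Type*} {G : SimpleGraph X} (S : ι → Set X)
    (hS : ∀ i, Dec K (⊤ : SimpleGraph (S i)))
    (hle : ∀ i, ∀ x ∈ S i, ∀ y ∈ S i, x ≠ y → G.Adj x y)
    (hcov : ∀ x y, G.Adj x y → ∃ i, x ∈ S i ∧ y ∈ S i)
    (huniq : ∀ x y, G.Adj x y → ∀ i j, x ∈ S i → y ∈ S i → x ∈ S j → y ∈ S j → i = j) :
    Dec K G := by
  refine Dec.glue hS (fun i => Subtype.val) (fun i => Subtype.val_injective) ?_ ?_ ?_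
  · intro i z z' h
    exact hle i _ z.2 _ z'.2 (fun h' => h.ne (Subtype.ext h'))
  · intro x y hxy
    obtain ⟨i, hx, hy⟩ := hcov x y hxy
    exact ⟨i, ⟨x, hx⟩, ⟨y, hy⟩, by simpa using hxy.ne, rfl, rfl⟩
  · intro i j z z' w w' h h' e e'
    have := hle i _ z.2 _ z'.2 (fun h' => h.ne (Subtype.ext h'))
    exact huniq _ _ this i j z.2 z'.2 (e ▸ w.2) (e' ▸ w'.2)

/-- A set closed under taking lines through two of its points. -/
def AffClosed {P n : ℕ} (A : Set (Fin n → ZMod P)) : Prop :=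
  ∀ x ∈ A, ∀ y ∈ A, ∀ c : ZMod P, x + c • (y - x) ∈ A

/-- The design of points and lines of an affine space over a prime field. -/
theorem exists_isDec_lines (P n : ℕ) [Fact P.Prime] :
    ∃ 𝓑, IsDec {P} (⊤ : SimpleGraph (Fin n → ZMod P)) 𝓑 ∧
      ∀ A : Set (Fin n → ZMod P), AffClosed A → ∀ B ∈ 𝓑, ∀ x ∈ B, ∀ y ∈ B,
        x ≠ y → x ∈ A → y ∈ A → ∀ z ∈ B, z ∈ A := by
  classical
  let line (b t : Fin n → ZMod P) : Finset (Fin n → ZMod P) :=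
    Finset.univ.image (fun c : ZMod P => b + c • t)
  have mem_line : ∀ b t z, z ∈ line b t ↔ ∃ c : ZMod P, b + c • t = z := by
    intro b t z; simp [line]
  have key : ∀ b t x y, x ∈ line b t → y ∈ line b t → x ≠ y → line b t = line x (y - x) := by
    intro b t x y hx hy hxy
    rw [mem_line] at hx hy
    obtain ⟨c, rfl⟩ := hx
    obtain ⟨d, rfl⟩ := hy
    have hcd : d - c ≠ 0 := by
      intro h
      rw [sub_eq_zero] at h
      exact hxy (by rw [h])
    ext z
    rw [mem_line, mem_line]
    constructor
    · rintro ⟨a, rfl⟩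
      refine ⟨(a - c) / (d - c), ?_⟩
      ext i
      simp only [Pi.add_apply, Pi.smul_apply, Pi.sub_apply, smul_eq_mul]
      field_simp
      ring
    · rintro ⟨a, rfl⟩
      refine ⟨c + a * (d - c), ?_⟩
      ext i
      simp only [Pi.add_apply, Pi.smul_apply, Pi.sub_apply, smul_eq_mul]
      ring
  refine ⟨{B | ∃ b t, t ≠ 0 ∧ B = line b t}, ⟨?_, ?_⟩, ?_⟩
  · rintro B ⟨b, t, ht, rfl⟩
    refine ⟨?_, fun x _ y _ hxy => by simpa using hxy⟩
    have : (line b t).card = P := by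
      rw [Finset.card_image_of_injective, Finset.card_univ, ZMod.card]
      intro c d hcd
      exact smul_left_injective _ ht (add_left_cancel hcd)
    simpa using this
  · intro x y hxy
    have hxy : x ≠ y := by simpa using hxy
    refine ⟨line x (y - x), ⟨⟨x, y - x, by simpa [sub_eq_zero] using hxy.symm, rfl⟩, ?_, ?_⟩, ?_⟩
    · rw [mem_line]; exact ⟨0, by simp⟩
    · rw [mem_line]; exact ⟨1, by simp⟩
    · rintro B ⟨⟨b, t, ht, rfl⟩, hx, hy⟩
      exact key b t x y hx hy hxy
  · rintro A hA B ⟨b, t, ht, rfl⟩ x hx y hy hxy hxA hyA z hz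
    rw [key b t x y hx hy hxy, mem_line] at hz
    obtain ⟨c, rfl⟩ := hz
    exact hA x hxA y hyA c

theorem Dec.prime_pow {K : Set ℕ} {P : ℕ} (hP : P.Prime) (h : Dec K (⊤ : SimpleGraph (Fin P)))
    (n : ℕ) : Dec K (⊤ : SimpleGraph (Fin (P ^ n))) := by
  have := Fact.mk hP
  obtain ⟨𝓑, h𝓑, -⟩ := exists_isDec_lines P n
  have h1 : Dec K (⊤ : SimpleGraph (Fin n → ZMod P)) :=
    Dec.refine ⟨𝓑, h𝓑⟩ (by rintro _ rfl; exact h)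
  exact Dec.top_congr (by simp) h1

/-- There is a commutative ring with `n` elements having `c` elements with pairwise differences
units. -/
def HasUD (c n : ℕ) : Prop :=
  ∃ (E : Type) (_ : CommRing E) (_ : Finite E), Nat.card E = n ∧
    ∃ μ : Fin c → E, ∀ i j, i ≠ j → IsUnit (μ i - μ j)

theorem HasUD.mul {c m n : ℕ} (hm : HasUD c m) (hn : HasUD c n) : HasUD c (m * n) := by
  obtain ⟨E, _, _, hE, μ, hμ⟩ := hm
  obtain ⟨F, _, _, hF, ν, hν⟩ := hn
  refine ⟨E × F, inferInstance, inferInstance, by rw [Nat.card_prod, hE, hF],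
    fun i => (μ i, ν i), fun i j hij => ?_⟩
  rw [Prod.isUnit_iff]
  exact ⟨hμ i j hij, hν i j hij⟩

theorem HasUD.one (c : ℕ) : HasUD c 1 :=
  ⟨PUnit, inferInstance, inferInstance, by simp, fun _ => 0, fun _ _ _ => isUnit_of_subsingleton _⟩

theorem HasUD.prime_pow {c p n : ℕ} (hp : p.Prime) (h : c ≤ p ^ n) : HasUD c (p ^ n) := by
  rcases Nat.eq_zero_or_pos n with rfl | hn
  · simpa using HasUD.one c
  have := Fact.mk hp
  have hcard := GaloisField.card p n hn.ne'
  have : Finite (GaloisField p n) := by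
    apply Nat.finite_of_card_ne_zero
    rw [hcard]
    exact (pow_pos hp.pos n).ne'
  let e : Fin (p ^ n) ≃ GaloisField p n := (Finite.card_eq.1 (by simp [hcard])).some
  refine ⟨GaloisField p n, inferInstance, inferInstance, hcard,
    fun i => e (Fin.castLE h i), fun i j hij => ?_⟩
  rw [isUnit_iff_ne_zero, sub_ne_zero]
  intro h
  exact hij (by simpa [Fin.ext_iff] using e.injective h)

theorem HasUD.of_factorization {c : ℕ} : ∀ {n : ℕ}, n ≠ 0 →
    (∀ p, p.Prime → p ∣ n → c ≤ p ^ n.factorization p) → HasUD c n := by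
  intro n
  induction n using Nat.recOnPosPrimePosCoprime with
  | zero => intro h; exact (h rfl).elim
  | one => intro _ _; exact HasUD.one c
  | prime_pow p n hp hn =>
    intro _ h
    refine HasUD.prime_pow hp ?_
    simpa [hp.factorization_self] using h p hp (dvd_pow_self p hn.ne')
  | coprime a b ha hb hab iha ihb =>
    intro _ h
    refine (iha (by omega) ?_).mul (ihb (by omega) ?_)
    · intro p hp hpa
      have := h p hp (hpa.mul_right b)
      rwa [Nat.factorization_eq_of_coprime_left hab (by simp [hp, hpa]; omega)] at this
    · intro p hp hpb
      have := h p hp (hpb.mul_left a)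
      rwa [Nat.factorization_eq_of_coprime_right hab (by simp [hp, hpb]; omega)] at this

/-- Truncated transversal designs. -/
theorem HasUD.dec_sigma {c T : ℕ} (hT : HasUD c T) {L : Set ℕ} {I : Type*} [Finite I]
    (hI : Nat.card I ≤ c) (g : I → ℕ) (hg : ∀ i, g i ≤ T)
    (hL : ∀ J : Set I, {i | g i = T} ⊆ J → J.ncard ≤ 1 ∨ J.ncard ∈ L) :
    Dec L (multipartite (Sigma.fst : (Σ i, Fin (g i)) → I)) := by
  obtain ⟨E, _, _, hE, μ', hμ'⟩ := hT
  let e : Fin T ≃ E := (Finite.card_eq.1 (by simp [hE])).some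
  let ι : I ≃ Fin (Nat.card I) := Finite.equivFin I
  let μ : I → E := fun i => μ' (Fin.castLE hI (ι i))
  have hμ : ∀ i j, i ≠ j → IsUnit (μ i - μ j) := by
    intro i j hij
    exact hμ' _ _ (fun h => hij (ι.injective (Fin.castLE_injective hI h)))
  let f : (Σ i, Fin (g i)) → E := fun p => e (Fin.castLE (hg p.1) p.2)
  have hf : ∀ p q : (Σ i, Fin (g i)), p.1 = q.1 → f p = f q → p = q := by
    rintro ⟨i, a⟩ ⟨j, b⟩ h h'
    obtain rfl : i = j := h
    have := e.injective h'
    simp only [Fin.ext_iff, Fin.val_castLE] at this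
    rw [Fin.ext this]
  refine Dec.of_cliques (fun b : E × E => {p | f p = b.1 + μ p.1 * b.2}) ?_ ?_ ?_ ?_
  · rintro ⟨x, y⟩
    let J : Set I := {i | ∃ a : Fin (g i), f ⟨i, a⟩ = x + μ i * y}
    have hc : Nat.card {p : (Σ i, Fin (g i)) | f p = x + μ p.1 * y} = J.ncard := by
      rw [← Nat.card_coe_set_eq]
      refine Nat.card_congr (Equiv.ofBijective (fun p => ⟨p.1.1, p.1.2, p.2⟩) ⟨?_, ?_⟩)
      · rintro ⟨p, hp⟩ ⟨q, hq⟩ h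
        have h : p.1 = q.1 := by simpa using h
        refine Subtype.ext (hf p q h ?_)
        rw [hp, hq, h]
      · rintro ⟨i, a, ha⟩
        exact ⟨⟨⟨i, a⟩, ha⟩, rfl⟩
    refine Dec.top_of_card_or ?_
    change Nat.card {p : (Σ i, Fin (g i)) | f p = x + μ p.1 * y} ≤ 1 ∨
      Nat.card {p : (Σ i, Fin (g i)) | f p = x + μ p.1 * y} ∈ L
    rw [hc]
    refine hL J ?_
    intro i hi
    refine ⟨Fin.cast hi.symm (e.symm (x + μ i * y)), ?_⟩
    have : Fin.castLE (hg i) (Fin.cast hi.out.symm (e.symm (x + μ i * y))) = e.symm (x + μ i * y) :=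
      Fin.ext rfl
    simp [f, this]
  · rintro ⟨x, y⟩ p hp q hq hpq
    rw [multipartite_adj]
    intro h
    refine hpq (hf p q h ?_)
    rw [hp.out, hq.out, h]
  · intro p q h
    rw [multipartite_adj] at h
    obtain ⟨u, hu⟩ := hμ _ _ h
    have hu' : (u⁻¹ : Eˣ) * (μ p.1 - μ q.1) = 1 := by rw [← hu]; simp
    refine ⟨⟨f p - μ p.1 * ((u⁻¹ : Eˣ) * (f p - f q)), (u⁻¹ : Eˣ) * (f p - f q)⟩, ?_, ?_⟩
    · simp
    · simp only [Set.mem_ofPred_eq]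
      linear_combination (f p - f q) * hu'
  · rintro p q h ⟨x, y⟩ ⟨x', y'⟩ h1 h2 h3 h4
    rw [multipartite_adj] at h
    simp only [Set.mem_ofPred_eq] at h1 h2 h3 h4
    have hy : y = y' := by
      refine (hμ _ _ h).mul_left_cancel ?_
      linear_combination -h1 + h2 + h3 - h4
    subst hy
    simp only [Prod.mk.injEq, and_true]
    linear_combination h3 - h1

theorem HasUD.gdd {c T k : ℕ} (hT : HasUD c T) (hk : k ≤ c) : GDD {k} T k := by
  have := hT.dec_sigma (L := {k}) (I := Fin k) (by simpa using hk) (fun _ => T) (fun _ => le_rfl)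
    (fun J hJ => by
      right
      have : J = Set.univ := by simpa [Set.univ_subset_iff] using hJ
      simp [this])
  refine GDD.of_dec (by simp) (fun i => ?_) this
  rw [Nat.card_congr (Equiv.sigmaSubtype i), Nat.card_fin]

theorem Dec.multipartite_of_rows {P m : ℕ} [Fact P.Prime] {R : Type*} [Finite R]
    (hR : Dec (Set.Icc (2 * m) P) (⊤ : SimpleGraph R)) (D : Set (ZMod P × R))
    (hrow : ∀ r, {i | (i, r) ∈ D}.ncard ≤ 1 ∨ m ≤ {i | (i, r) ∈ D}.ncard)
    (hfull : {r | ∃ i, (i, r) ∉ D}.ncard ≤ m) :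
    Dec (Set.Icc m P) (multipartite (fun x : D => x.1.1)) := by
  classical
  obtain ⟨𝓑, h1, h2⟩ := hR
  have hemb : ∀ B : 𝓑, ∃ a : R → ZMod P, Set.InjOn a (B.1 : Set R) := by
    intro B
    obtain ⟨f⟩ : Nonempty (B.1 ↪ ZMod P) :=
      Function.Embedding.nonempty_of_card_le (by simpa using (h1 B.1 B.2).1.2)
    refine ⟨fun r => if h : r ∈ B.1 then f ⟨r, h⟩ else 0, fun r hr s hs h => ?_⟩
    simpa [Finset.mem_coe.1 hr, Finset.mem_coe.1 hs] using h
  choose a ha using hemb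
  let S : R ⊕ (𝓑 × ZMod P × {t : ZMod P // t ≠ 0}) → Set D
    | .inl r => {x | x.1.2 = r}
    | .inr c => {x | x.1.2 ∈ c.1.1 ∧ x.1.1 = c.2.1 + a c.1 x.1.2 * c.2.2}
  have hblock : ∀ c, ∀ x ∈ S (.inr c), ∀ y ∈ S (.inr c),
      (x.1.1 = y.1.1 ∨ x.1.2 = y.1.2) → x = y := by
    rintro ⟨B, b, t, ht⟩ x ⟨hx, hx'⟩ y ⟨hy, hy'⟩ h
    have h2 : x.1.2 = y.1.2 := by
      rcases h with h | h
      · refine ha B hx hy ?_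
        rw [hx', hy'] at h
        exact mul_right_cancel₀ ht (add_left_cancel h)
      · exact h
    refine Subtype.ext (Prod.ext ?_ h2)
    rw [hx', hy', h2]
  refine Dec.of_cliques S ?_ ?_ ?_ ?_
  · rintro (r | ⟨B, b, t, ht⟩)
    · have hc : Nat.card (S (.inl r)) = {i | (i, r) ∈ D}.ncard := by
        rw [← Nat.card_coe_set_eq]
        refine Nat.card_congr (Equiv.ofBijective (fun x => ⟨x.1.1.1, ?_⟩) ⟨?_, ?_⟩)
        · obtain ⟨⟨⟨i, s⟩, hD⟩, hx⟩ := x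
          obtain rfl : s = r := hx
          exact hD
        · rintro ⟨x, hx⟩ ⟨y, hy⟩ h
          have h : x.1.1 = y.1.1 := by simpa using h
          exact Subtype.ext (Subtype.ext (Prod.ext h (hx.trans hy.symm)))
        · rintro ⟨i, hi⟩
          exact ⟨⟨⟨(i, r), hi⟩, rfl⟩, rfl⟩
      refine Dec.top_of_card_or ?_
      rw [hc]
      refine (hrow r).imp_right (fun h => ⟨h, ?_⟩)
      simpa using Set.ncard_le_card {i | (i, r) ∈ D}
    · let J : Set R := {r | r ∈ B.1 ∧ (b + a B r * t, r) ∈ D}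
      have hc : Nat.card (S (.inr ⟨B, b, t, ht⟩)) = J.ncard := by
        rw [← Nat.card_coe_set_eq]
        refine Nat.card_congr (Equiv.ofBijective (fun x => ⟨x.1.1.2, ?_⟩) ⟨?_, ?_⟩)
        · obtain ⟨⟨⟨i, r⟩, hx⟩, hr, hi⟩ := x
          dsimp only at hr hi ⊢
          subst hi
          exact ⟨hr, hx⟩
        · rintro ⟨x, hx⟩ ⟨y, hy⟩ h
          exact Subtype.ext (hblock _ _ hx _ hy (.inr (by simpa using h)))
        · rintro ⟨r, hr, hD⟩
          exact ⟨⟨⟨_, hD⟩, hr, rfl⟩, rfl⟩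
      refine Dec.top_of_card_or (.inr ?_)
      rw [hc]
      have hB := (h1 B.1 B.2).1
      have hJ : J ⊆ B.1 := fun r hr => hr.1
      have hBJ : (B.1 : Set R) ⊆ J ∪ {r | ∃ i, (i, r) ∉ D} := by
        intro r hr
        by_cases h : (b + a B r * t, r) ∈ D
        · exact .inl ⟨hr, h⟩
        · exact .inr ⟨_, h⟩
      have h3 := Set.ncard_le_ncard hJ (Finset.finite_toSet _)
      have h4 := (Set.ncard_le_ncard hBJ (Set.toFinite _)).trans (Set.ncard_union_le _ _)
      rw [Set.ncard_coe_finset] at h3 h4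
      have := hB.1
      exact ⟨by omega, h3.trans hB.2⟩
  · rintro (r | c) x hx y hy hxy
    · rw [multipartite_adj]
      exact fun h => hxy (Subtype.ext (Prod.ext h (hx.out.trans hy.out.symm)))
    · rw [multipartite_adj]
      exact fun h => hxy (hblock c x hx y hy (.inl h))
  · intro x y hxy
    rw [multipartite_adj] at hxy
    by_cases hr : x.1.2 = y.1.2
    · exact ⟨.inl x.1.2, rfl, hr.symm⟩
    · obtain ⟨B, ⟨hB, hx, hy⟩, -⟩ := h2 x.1.2 y.1.2 (by simpa using hr)
      have hd : a ⟨B, hB⟩ x.1.2 - a ⟨B, hB⟩ y.1.2 ≠ 0 := by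
        rw [sub_ne_zero]
        exact fun h => hr (ha ⟨B, hB⟩ hx hy h)
      have hd' : x.1.1 - y.1.1 ≠ 0 := sub_ne_zero.2 hxy
      refine ⟨.inr ⟨⟨B, hB⟩, x.1.1 - a ⟨B, hB⟩ x.1.2 * ((x.1.1 - y.1.1) /
        (a ⟨B, hB⟩ x.1.2 - a ⟨B, hB⟩ y.1.2)), ⟨_, div_ne_zero hd' hd⟩⟩, ⟨hx, ?_⟩, ⟨hy, ?_⟩⟩
      · simp
      · dsimp only
        field_simp
        ring
  · intro x y hxy i j hxi hyi hxj hyj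
    rw [multipartite_adj] at hxy
    have hne : x ≠ y := fun h => hxy (by rw [h])
    rcases i with r | ⟨B, b, t, ht⟩ <;> rcases j with s | ⟨C, c, u, hu⟩
    · rw [← hxi.out, ← hxj.out]
    · exact (hne (hblock _ _ hxj _ hyj (.inr (hxi.out.trans hyi.out.symm)))).elim
    · exact (hne (hblock _ _ hxi _ hyi (.inr (hxj.out.trans hyj.out.symm)))).elim
    · have hr : x.1.2 ≠ y.1.2 := fun h => hne (hblock _ _ hxi _ hyi (.inr h))
      obtain ⟨hxB, hx⟩ := hxi
      obtain ⟨hyB, hy⟩ := hyi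
      obtain ⟨hxC, hx'⟩ := hxj
      obtain ⟨hyC, hy'⟩ := hyj
      obtain rfl : B = C := Subtype.ext ((h2 x.1.2 y.1.2 (by simpa using hr)).unique
        ⟨B.2, hxB, hyB⟩ ⟨C.2, hxC, hyC⟩)
      dsimp only at hx hy hx' hy' hxB hyB
      have hd : a B x.1.2 - a B y.1.2 ≠ 0 := by
        rw [sub_ne_zero]
        exact fun h => hr (ha B hxB hyB h)
      have htu : t = u := by
        refine mul_left_cancel₀ hd ?_
        linear_combination -hx + hy + hx' - hy'
      subst htu
      have hbc : b = c := by linear_combination hx' - hx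
      rw [hbc]

theorem Dec.multipartite_columns {P m W : ℕ} [Fact P.Prime] (hm : 1 ≤ m)
    (hW : ∀ W', W ≤ W' → W' ≤ W + m → Dec (Set.Icc (2 * m) P) (⊤ : SimpleGraph (Fin W')))
    {I : Type*} [Finite I] (hI : Nat.card I = P) (w : I → ℕ) (hw : ∀ i, w i = W ∨ w i = W + 1) :
    Dec (Set.Icc m P) (multipartite (Sigma.fst : (Σ i, Fin (w i)) → I)) := by
  classical
  let e : ZMod P ≃ I := (Finite.card_eq.1 (by simp [hI])).some
  let S : Set (ZMod P) := {i | w (e i) = W + 1}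
  have main : ∀ {Q : Type} [Finite Q] (σ : S → Q), Nat.card Q ≤ m →
      (∀ q, {i | σ i = q}.ncard ≤ 1 ∨ m ≤ {i | σ i = q}.ncard) →
      Dec (Set.Icc m P) (multipartite (Sigma.fst : (Σ i, Fin (w i)) → I)) := by
    intro Q _ σ hQ hσ
    have hR : Dec (Set.Icc (2 * m) P) (⊤ : SimpleGraph (Fin W ⊕ Q)) :=
      Dec.top_congr (by simp) (hW (W + Nat.card Q) (by omega) (by omega))
    let D : Set (ZMod P × (Fin W ⊕ Q)) := {x | ∀ q, x.2 = .inr q → ∃ h : x.1 ∈ S, σ ⟨x.1, h⟩ = q}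
    have hD := Dec.multipartite_of_rows hR D ?_ ?_
    · refine Dec.multipartite_congr e (fun i => ?_) hD
      rw [Nat.card_congr (Equiv.sigmaSubtype (e i)), Nat.card_fin]
      by_cases hi : i ∈ S
      · have : Nat.card (Option (Fin W)) = w (e i) := by
          rw [Finite.card_option, Nat.card_fin, hi.out]
        rw [← this]
        symm
        refine Nat.card_congr (Equiv.ofBijective (fun o => match o with
          | none => ⟨⟨(i, .inr (σ ⟨i, hi⟩)), fun q hq => ⟨hi, by simpa using hq⟩⟩, rfl⟩
          | some r => ⟨⟨(i, .inl r), fun q hq => by simp at hq⟩, rfl⟩) ⟨?_, ?_⟩)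
        · rintro (_ | r) (_ | s) h <;> simp at h ⊢
          exact h
        · rintro ⟨⟨⟨j, r | q⟩, hx⟩, rfl⟩
          · exact ⟨some r, rfl⟩
          · obtain ⟨h, hq⟩ := hx q rfl
            exact ⟨none, Subtype.ext (Subtype.ext (Prod.ext rfl (congrArg Sum.inr hq)))⟩
      · have : Nat.card (Fin W) = w (e i) := by
          rw [Nat.card_fin, (hw _).resolve_right hi]
        rw [← this]
        symm
        refine Nat.card_congr (Equiv.ofBijective
          (fun r => ⟨⟨(i, .inl r), fun q hq => by simp at hq⟩, rfl⟩) ⟨?_, ?_⟩)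
        · intro r s h
          simpa using h
        · rintro ⟨⟨⟨j, r | q⟩, hx⟩, rfl⟩
          · exact ⟨r, rfl⟩
          · obtain ⟨h, -⟩ := hx q rfl
            exact (hi h).elim
    · rintro (r | q)
      · right
        have h1 : {i | (i, (Sum.inl r : Fin W ⊕ Q)) ∈ D} = Set.univ := by
          ext i
          simp [D]
        have h2 := hW W le_rfl (by omega)
        rw [h1, Set.ncard_univ, Nat.card_zmod]
        obtain ⟨𝓑, h3, h4⟩ := hW (W + 1) (by omega) (by omega)
        by_cases hW1 : W = 0
        · subst hW1
          exact r.elim0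
        · have : (⟨0, by omega⟩ : Fin (W + 1)) ≠ ⟨1, by omega⟩ := by simp
          obtain ⟨B, ⟨hB, -⟩, -⟩ := h4 _ _ this
          have := (h3 B hB).1
          have := this.1.trans this.2
          omega
      · have h1 : {i | (i, (Sum.inr q : Fin W ⊕ Q)) ∈ D} = Subtype.val '' {i | σ i = q} := by
          ext i
          simp [D]
        rw [h1, Set.ncard_image_of_injective _ Subtype.val_injective]
        exact hσ q
    · refine le_trans ?_ hQ
      rw [← Set.ncard_univ,
        ← Set.ncard_image_of_injective (Set.univ : Set Q) (Sum.inr_injective (α := Fin W))]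
      refine Set.ncard_le_ncard ?_ (Set.toFinite _)
      rintro (r | q) ⟨i, hi⟩
      · exact (hi (fun q hq => by simp at hq)).elim
      · exact ⟨q, trivial, rfl⟩
  rcases lt_or_ge S.ncard m with h | h
  · refine main (id : S → S) ?_ (fun q => .inl ?_)
    · rw [Nat.card_coe_set_eq]; exact h.le
    · simp
  · refine main (fun _ => () : S → Unit) (by simpa using hm) (fun q => .inr ?_)
    have : {i : S | () = q} = Set.univ := by
      ext i
      simp
    rwa [this, Set.ncard_univ, Nat.card_coe_set_eq]

/-- A point set over an affine space, decomposed so that subspaces give flats. -/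
theorem exists_isDec_over_affine {P m W n : ℕ} [Fact P.Prime] (hm : 1 ≤ m)
    (hW : ∀ W', W ≤ W' → W' ≤ W + m → Dec (Set.Icc (2 * m) P) (⊤ : SimpleGraph (Fin W')))
    (w : (Fin n → ZMod P) → ℕ) (hw : ∀ v, w v = W ∨ w v = W + 1) :
    ∃ 𝓑, IsDec (Set.Icc m P) (multipartite (Sigma.fst : (Σ v, Fin (w v)) → _)) 𝓑 ∧
      ∀ A : Set (Fin n → ZMod P), AffClosed A → ∀ B ∈ 𝓑, ∀ x ∈ B, ∀ y ∈ B, x ≠ y →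
        x.1 ∈ A → y.1 ∈ A → ∀ z ∈ B, z.1 ∈ A := by
  obtain ⟨𝓛, hL, hA⟩ := exists_isDec_lines P n
  have hcol : ∀ B : 𝓛, Dec (Set.Icc m P)
      (multipartite (Sigma.fst : (Σ v : B.1, Fin (w v.1)) → B.1)) := by
    intro B
    refine Dec.multipartite_columns hm hW ?_ _ (fun v => hw v.1)
    simpa using (hL.1 B.1 B.2).1
  choose 𝓒 h𝓒 using hcol
  let φ : ∀ B : 𝓛, (Σ v : B.1, Fin (w v.1)) ↪ (Σ v, Fin (w v)) := fun B =>
    ⟨fun x => ⟨x.1.1, x.2⟩, by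
      rintro ⟨⟨x, hx⟩, a⟩ ⟨⟨y, hy⟩, b⟩ h
      simp only [Sigma.mk.injEq] at h
      obtain ⟨rfl, h⟩ := h
      rw [heq_iff_eq] at h
      rw [h]⟩
  refine ⟨_, IsDec.glue h𝓒 φ ?_ ?_ ?_, ?_⟩
  · intro B z z' h
    rw [multipartite_adj] at h ⊢
    exact fun h' => h (Subtype.ext h')
  · rintro ⟨x, a⟩ ⟨y, b⟩ hxy
    rw [multipartite_adj] at hxy
    obtain ⟨B, ⟨hB, hx, hy⟩, -⟩ := hL.2 x y (by simpa using hxy)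
    refine ⟨⟨B, hB⟩, ⟨⟨x, hx⟩, a⟩, ⟨⟨y, hy⟩, b⟩, ?_, rfl, rfl⟩
    rw [multipartite_adj]
    exact fun h' => hxy (congrArg Subtype.val h')
  · intro B C z z' u u' h h' e e'
    rw [multipartite_adj] at h
    have hne : (z.1 : Fin n → ZMod P) ≠ z'.1 := fun h' => h (Subtype.ext h')
    have e1 : (z.1 : Fin n → ZMod P) = u.1 := congrArg Sigma.fst e
    have e2 : (z'.1 : Fin n → ZMod P) = u'.1 := congrArg Sigma.fst e'
    refine Subtype.ext ((hL.2 _ _ (by simpa using hne)).unique ⟨B.2, z.1.2, z'.1.2⟩ ⟨C.2, ?_, ?_⟩)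
    · rw [e1]; exact u.1.2
    · rw [e2]; exact u'.1.2
  · rintro A hAc _ ⟨B, C, hC, rfl⟩ x hx y hy hxy hxA hyA z hz
    rw [Finset.mem_map] at hx hy hz
    obtain ⟨x, hx, rfl⟩ := hx
    obtain ⟨y, hy, rfl⟩ := hy
    obtain ⟨z, hz, rfl⟩ := hz
    have h := ((h𝓒 B).1 C hC).2 x hx y hy (fun h => hxy (by rw [h]))
    rw [multipartite_adj] at h
    exact hA A hAc B.1 B.2 _ x.1.2 _ y.1.2 (fun h' => h (Subtype.ext h')) hxA hyA _ z.1.2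

theorem exists_balanced {V : Type*} [Finite V] (W r : ℕ) (hr : r ≤ Nat.card V) :
    ∃ w : V → ℕ, (∀ v, w v = W ∨ w v = W + 1) ∧
      Nat.card (Σ v, Fin (w v)) = W * Nat.card V + r := by
  classical
  have := Fintype.ofFinite V
  obtain ⟨S, -, hS⟩ := Finset.exists_subset_card_eq (s := (Finset.univ : Finset V)) (n := r)
    (by rwa [Finset.card_univ, ← Nat.card_eq_fintype_card])
  refine ⟨fun v => W + if v ∈ S then 1 else 0, fun v => ?_, ?_⟩
  · by_cases h : v ∈ S <;> simp [h]
  · rw [Nat.card_eq_fintype_card, Fintype.card_sigma]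
    simp [Finset.sum_add_distrib, hS, mul_comm]

theorem exists_mul_pow_add {P W₀ u : ℕ} (hP : 2 ≤ P) (hW₀ : 1 ≤ W₀) (hu : W₀ ≤ u) :
    ∃ n W r, W₀ ≤ W ∧ W < W₀ * P ∧ r < P ^ n ∧ u = W * P ^ n + r := by
  have hex : ∃ n, u < W₀ * P ^ (n + 1) := by
    refine ⟨u, ?_⟩
    have : u + 1 < P ^ (u + 1) := Nat.lt_pow_self hP
    nlinarith
  have h1 := Nat.find_spec hex
  set n := Nat.find hex with hn
  have h2 : W₀ * P ^ n ≤ u := by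
    rcases Nat.eq_zero_or_pos n with h0 | h0
    · rw [h0]; simpa using hu
    · have := Nat.find_min hex (m := n - 1) (by omega)
      rw [Nat.sub_add_cancel h0] at this
      omega
  have hpos : 0 < P ^ n := by positivity
  refine ⟨n, u / P ^ n, u % P ^ n, (Nat.le_div_iff_mul_le hpos).2 h2,
    (Nat.div_lt_iff_lt_mul hpos).2 ?_, Nat.mod_lt _ hpos, ?_⟩
  · rw [mul_assoc, ← pow_succ']
    exact h1
  · rw [mul_comm]
    exact (Nat.div_add_mod _ _).symm

theorem Dec.of_prime_mul {m p u : ℕ} (hm : 1 ≤ m) (hp : p.Prime) (h1 : 2 * m * p ≤ u)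
    (h2 : u ≤ p * (p - m)) : Dec (Set.Icc m p) (⊤ : SimpleGraph (Fin u)) := by
  have := Fact.mk hp
  set w := u / p with hwdef
  have hw1 : 2 * m ≤ w := (Nat.le_div_iff_mul_le hp.pos).2 h1
  have hw2 : w ≤ p - m := Nat.div_le_of_le_mul h2
  obtain ⟨f, hf, hc⟩ := exists_balanced (V := ZMod p) w (u % p)
    (by simpa using (Nat.mod_lt _ hp.pos).le)
  have h3 := Dec.multipartite_columns (P := p) (m := m) (W := w) hm
    (fun W' h h' => Dec.top_of_card (by rw [Nat.card_fin]; constructor <;> omega))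
    (I := ZMod p) (by simp) f hf
  refine Dec.top_congr (X := Σ v, Fin (f v)) ?_ (h3.fill fun i => Dec.top_of_card ?_)
  · rw [hc, Nat.card_zmod, Nat.card_fin, mul_comm]
    exact Nat.div_add_mod _ _
  · rw [Nat.card_congr (Equiv.sigmaSubtype i), Nat.card_fin]
    rcases hf i with h | h <;> rw [h] <;> constructor <;> omega

theorem Dec.Icc_two_mul_sqrt {m u : ℕ} (hm : 1 ≤ m) (hu : 64 * m ^ 2 ≤ u) :
    Dec (Set.Icc m (2 * (u.sqrt + m))) (⊤ : SimpleGraph (Fin u)) := by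
  obtain ⟨p, hp, h1, h2⟩ := Nat.exists_prime_lt_and_le_two_mul (u.sqrt + m) (by omega)
  have hs1 : u < (u.sqrt + 1) * (u.sqrt + 1) := Nat.lt_succ_sqrt u
  have hs2 : u.sqrt * u.sqrt ≤ u := Nat.sqrt_le u
  have hs3 : 8 * m ≤ u.sqrt := Nat.le_sqrt.2 (by linarith [hu])
  refine Dec.mono (Set.Icc_subset_Icc_right h2) (Dec.of_prime_mul hm hp ?_ ?_)
  · nlinarith
  · have : u.sqrt + 1 ≤ p - m := by omega
    calc u ≤ (u.sqrt + 1) * (u.sqrt + 1) := hs1.le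
      _ ≤ p * (p - m) := Nat.mul_le_mul (by omega) this

theorem exists_dec_Icc {m : ℕ} (hm : 1 ≤ m) :
    ∃ q u₀, ∀ u, u₀ ≤ u → Dec (Set.Icc m q) (⊤ : SimpleGraph (Fin u)) := by
  set W₀ := 64 * (2 * m) ^ 2 with hW₀
  obtain ⟨P, hP1, hP⟩ := Nat.exists_infinite_primes (32 * W₀)
  have := Fact.mk hP
  have hmW : m ≤ W₀ := by nlinarith
  have hmW' : 2 * m ≤ W₀ := by nlinarith
  refine ⟨W₀ * P + P, W₀, fun u hu => ?_⟩
  obtain ⟨n, W, r, h1, h2, h3, rfl⟩ := exists_mul_pow_add hP.two_le (by omega) hu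
  obtain ⟨w, hw, hc⟩ := exists_balanced (V := Fin n → ZMod P) W r (by simpa using h3.le)
  have hrows : ∀ W', W ≤ W' → W' ≤ W + m → Dec (Set.Icc (2 * m) P) (⊤ : SimpleGraph (Fin W')) := by
    intro W' hW1 hW2
    refine Dec.mono (Set.Icc_subset_Icc_right ?_)
      (Dec.Icc_two_mul_sqrt (m := 2 * m) (by omega) (by omega))
    have hs : W'.sqrt * W'.sqrt ≤ W' := Nat.sqrt_le W'
    have h5 : 4 * W'.sqrt ≤ P := by
      by_contra! h
      nlinarith
    omega
  obtain ⟨𝓑, h𝓑, -⟩ := exists_isDec_over_affine hm hrows w hw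
  have h4 : Dec (Set.Icc m (W₀ * P + P)) (multipartite (Sigma.fst : (Σ v, Fin (w v)) → _)) :=
    Dec.mono (Set.Icc_subset_Icc_right (by omega)) ⟨𝓑, h𝓑⟩
  have hP2 := hP.two_le
  refine Dec.top_congr ?_ (h4.fill fun i => Dec.top_of_card ?_)
  · rw [hc]; simp
  · rw [Nat.card_congr (Equiv.sigmaSubtype i), Nat.card_fin]
    rcases hw i with h | h <;> rw [h] <;> constructor <;> omega

/-- A family of subsets of a set `Y`, with sizes in `K`, such that any two points lie in exactly
`lam` members of the family. -/
def HasBIBD (K : Set ℕ) (l lam : ℕ) : Prop :=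
  ∃ (I : Type) (_ : Finite I) (B : I → Finset (Fin l)), (∀ i, (B i).card ∈ K) ∧
    ∀ y y', y ≠ y' → Nat.card {i // y ∈ B i ∧ y' ∈ B i} = lam

theorem exists_weighted_sum {E G Y : Type*} [CommRing E] [AddCommGroup G] [Module E G] [Fintype Y]
    [DecidableEq Y] (μ : Option Y → E) (hμ : ∀ i j, i ≠ j → IsUnit (μ i - μ j))
    (ν : Option Y → Y → E) (hν : ∀ c y, ν c y = if c = some y then μ none else μ (some y))
    (y : Y) (h : Y → G) :
    ∃ a : Option Y → G, ∀ y', y' ≠ y →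
      ∑ c, Ring.inverse (ν c y - ν c y') • a c = h y' := by
  have hu : ∀ y', y' ≠ y → IsUnit (Ring.inverse (μ (some y) - μ (some y')) -
      Ring.inverse (μ (some y) - μ none)) := by
    intro y' hy
    have h1 := hμ (some y) (some y') (by simpa using hy.symm)
    have h2 := hμ (some y) none (by simp)
    have h3 := hμ (some y') none (by simp)
    have e1 := Ring.mul_inverse_cancel _ h1
    have e2 := Ring.mul_inverse_cancel _ h2
    have : Ring.inverse (μ (some y) - μ (some y')) - Ring.inverse (μ (some y) - μ none) =
        (μ (some y') - μ none) * (Ring.inverse (μ (some y) - μ (some y')) *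
          Ring.inverse (μ (some y) - μ none)) := by
      linear_combination (Ring.inverse (μ (some y) - μ none)) * e1 -
        (Ring.inverse (μ (some y) - μ (some y'))) * e2
    rw [this]
    exact h3.mul (h1.ringInverse.mul h2.ringInverse)
  let t : Y → G := fun y' => if y' = y then 0 else
    Ring.inverse (Ring.inverse (μ (some y) - μ (some y')) -
      Ring.inverse (μ (some y) - μ none)) • h y'
  refine ⟨fun c => match c with | none => ∑ z, t z | some z => - t z, fun y' hy => ?_⟩
  rw [Fintype.sum_option]
  have h1 : ν none y - ν none y' = μ (some y) - μ (some y') := by simp [hν]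
  have h2 : ∀ z, Ring.inverse (ν (some z) y - ν (some z) y') • (- t z) =
      - (Ring.inverse (μ (some y) - μ (some y')) • t z) +
        if z = y' then (Ring.inverse (μ (some y) - μ (some y')) -
          Ring.inverse (μ (some y) - μ none)) • t y' else 0 := by
    intro z
    by_cases hz : z = y
    · subst hz
      simp [t, hy.symm]
    · by_cases hz' : z = y'
      · subst hz'
        simp only [hν, Option.some.injEq, hz, if_false, if_true]
        rw [smul_neg, sub_smul]
        abel
      · simp only [hν, Option.some.injEq, hz, hz', if_false]
        rw [smul_neg, add_zero]
  simp only [h2, h1, Finset.sum_add_distrib, Finset.sum_neg_distrib, ← Finset.smul_sum,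
    Finset.sum_ite_eq', Finset.mem_univ, if_true]
  rw [add_neg_cancel_left]
  simp only [t, hy, if_false]
  rw [smul_smul, Ring.mul_inverse_cancel _ (hu y' hy), one_smul]

theorem HasBIBD.gdd {K : Set ℕ} {l : ℕ} {E G : Type} [CommRing E] [AddCommGroup G] [Module E G]
    [Finite G] (μ : Option (Fin l) → E) (hμ : ∀ i j, i ≠ j → IsUnit (μ i - μ j))
    (h : HasBIBD K l (Nat.card G)) : GDD K (Nat.card G ^ (l + 1)) l := by
  classical
  obtain ⟨I, _, B, hBK, hB⟩ := h
  have hg : ∀ y y' : Fin l, y ≠ y' →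
      ∃ g : I → G, ∀ x, ∃! i, (y ∈ B i ∧ y' ∈ B i) ∧ g i = x := by
    intro y y' hy
    let e : {i // y ∈ B i ∧ y' ∈ B i} ≃ G := (Finite.card_eq.1 (hB y y' hy)).some
    refine ⟨fun i => if h : y ∈ B i ∧ y' ∈ B i then e ⟨i, h⟩ else 0, fun x => ?_⟩
    refine ⟨(e.symm x).1, ⟨(e.symm x).2, ?_⟩, ?_⟩
    · simp [(e.symm x).2]
    · rintro i ⟨hi, rfl⟩
      simp [hi]
  choose! g hg using hg
  let ν : Option (Fin l) → Fin l → E := fun c y => if c = some y then μ none else μ (some y)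
  have hν : ∀ c y y', y ≠ y' → IsUnit (ν c y - ν c y') := by
    intro c y y' hy
    by_cases h1 : c = some y <;> by_cases h2 : c = some y'
    · exact (hy (by simpa using h1.symm.trans h2)).elim
    all_goals simp only [ν, h1, h2, if_true, if_false]
    · rw [if_neg (by simpa using hy)]
      exact hμ _ _ (by simp)
    · rw [if_neg (by simpa using hy.symm)]
      exact hμ _ _ (by simp)
    · exact hμ _ _ (by simpa using hy)
  have ha := fun (i : I) (y : Fin l) => exists_weighted_sum μ hμ ν (fun _ _ => rfl) y
    (fun y' => if y' < y then g y' y i else 0)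
  choose a ha using ha
  have key : ∀ y y', y < y' → ∀ i,
      ∑ c, Ring.inverse (ν c y - ν c y') • (a i y c - a i y' c) = g y y' i := by
    intro y y' hy i
    have h1 := ha i y y' hy.ne'
    have h2 := ha i y' y hy.ne
    rw [if_neg hy.not_gt] at h1
    rw [if_pos hy] at h2
    rw [← h2, ← sub_eq_zero, ← h1, ← Finset.sum_sub_distrib]
    refine Finset.sum_congr rfl (fun c _ => ?_)
    have : Ring.inverse (ν c y - ν c y') = - Ring.inverse (ν c y' - ν c y) := by
      refine (hν c y y' hy.ne).mul_left_cancel ?_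
      rw [Ring.mul_inverse_cancel _ (hν c y y' hy.ne)]
      linear_combination - Ring.mul_inverse_cancel _ (hν c y' y hy.ne')
    rw [this]
    module
  let S : I × (Option (Fin l) → G) × {z : Option (Fin l) → G // ∑ c, z c = 0} →
      Set (Fin l × (Option (Fin l) → G)) := fun b =>
    {p | p.1 ∈ B b.1 ∧ ∀ c, p.2 c = b.2.1 c + ν c p.1 • b.2.2.1 c + a b.1 p.1 c}
  have hS : ∀ b p q, p ∈ S b → q ∈ S b → p.1 = q.1 → p = q := by
    rintro b p q hp hq h
    refine Prod.ext h (funext fun c => ?_)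
    rw [hp.2, hq.2, h]
  have hex : ∀ p q : Fin l × (Option (Fin l) → G), p.1 < q.1 → ∃ b, p ∈ S b ∧ q ∈ S b := by
    intro p q h
    obtain ⟨i, ⟨⟨hp, hq⟩, hi⟩, -⟩ := hg p.1 q.1 h.ne
      (∑ c, Ring.inverse (ν c p.1 - ν c q.1) • (p.2 c - q.2 c))
    let z : Option (Fin l) → G := fun c =>
      Ring.inverse (ν c p.1 - ν c q.1) • (p.2 c - q.2 c - (a i p.1 c - a i q.1 c))
    have hz : ∑ c, z c = 0 := by
      simp only [z, smul_sub _ (_ - _) (_ - _), Finset.sum_sub_distrib]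
      rw [key _ _ h, hi, sub_self]
    refine ⟨(i, fun c => p.2 c - ν c p.1 • z c - a i p.1 c, ⟨z, hz⟩), ⟨hp, fun c => ?_⟩,
      ⟨hq, fun c => ?_⟩⟩
    · dsimp only
      abel
    · have : (ν c p.1 - ν c q.1) • z c = p.2 c - q.2 c - (a i p.1 c - a i q.1 c) := by
        simp only [z]
        rw [smul_smul, Ring.mul_inverse_cancel _ (hν c _ _ h.ne), one_smul]
      rw [sub_smul, sub_eq_iff_eq_add] at this
      dsimp only
      rw [this]
      abel
  have huniq : ∀ p q : Fin l × (Option (Fin l) → G), p.1 < q.1 → ∀ b b', p ∈ S b → q ∈ S b →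
      p ∈ S b' → q ∈ S b' → b = b' := by
    intro p q h
    have hz : ∀ b, p ∈ S b → q ∈ S b → ∀ c, b.2.2.1 c =
        Ring.inverse (ν c p.1 - ν c q.1) • (p.2 c - q.2 c - (a b.1 p.1 c - a b.1 q.1 c)) := by
      rintro b hp hq c
      have : p.2 c - q.2 c - (a b.1 p.1 c - a b.1 q.1 c) = (ν c p.1 - ν c q.1) • b.2.2.1 c := by
        rw [hp.2, hq.2]
        module
      rw [this, smul_smul, Ring.inverse_mul_cancel _ (hν c _ _ h.ne), one_smul]
    have hi : ∀ b, p ∈ S b → q ∈ S b → g p.1 q.1 b.1 =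
        ∑ c, Ring.inverse (ν c p.1 - ν c q.1) • (p.2 c - q.2 c) := by
      intro b hp hq
      have h0 := b.2.2.2
      simp only [hz b hp hq, smul_sub _ (_ - _) (_ - _), Finset.sum_sub_distrib] at h0
      rw [key _ _ h, sub_eq_zero] at h0
      exact h0.symm
    rintro ⟨i, z₁, z₂⟩ ⟨i', z₁', z₂'⟩ hp hq hp' hq'
    obtain rfl : i = i' := (hg p.1 q.1 h.ne _).unique ⟨⟨hp.1, hq.1⟩, hi _ hp hq⟩
      ⟨⟨hp'.1, hq'.1⟩, hi _ hp' hq'⟩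
    obtain rfl : z₂ = z₂' := Subtype.ext (funext fun c =>
      (hz _ hp hq c).trans (hz _ hp' hq' c).symm)
    have : z₁ = z₁' := by
      funext c
      have := (hp.2 c).symm.trans (hp'.2 c)
      simpa using this
    rw [this]
  have hdec : Dec K (multipartite (Prod.fst : Fin l × (Option (Fin l) → G) → Fin l)) := by
    refine Dec.of_cliques S ?_ ?_ ?_ ?_
    · rintro b
      refine Dec.top_of_card ?_
      have : Nat.card (S b) = (B b.1).card := by
        rw [← Nat.card_eq_finsetCard]
        refine Nat.card_congr (Equiv.ofBijective (fun p => ⟨p.1.1, p.2.1⟩) ⟨?_, ?_⟩)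
        · intro p q h
          exact Subtype.ext (hS b _ _ p.2 q.2 (by simpa using h))
        · rintro ⟨y, hy⟩
          exact ⟨⟨(y, fun c => b.2.1 c + ν c y • b.2.2.1 c + a b.1 y c), hy, fun c => rfl⟩, rfl⟩
      rw [this]
      exact hBK _
    · intro b p hp q hq hpq
      rw [multipartite_adj]
      exact fun h => hpq (hS b p q hp hq h)
    · intro p q h
      rw [multipartite_adj] at h
      rcases lt_or_gt_of_ne h with h | h
      · exact hex p q h
      · obtain ⟨b, h1, h2⟩ := hex q p h
        exact ⟨b, h2, h1⟩
    · intro p q h b b' h1 h2 h3 h4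
      rw [multipartite_adj] at h
      rcases lt_or_gt_of_ne h with h | h
      · exact huniq p q h b b' h1 h2 h3 h4
      · exact huniq q p h b b' h2 h1 h4 h3
  refine GDD.of_dec (by simp) (fun i => ?_) hdec
  rw [card_fiber_fst, Nat.card_fun, Finite.card_option, Nat.card_fin]

theorem GDD.mul {K L : Set ℕ} {g h l : ℕ} (hg : GDD L g l) (hh : ∀ k ∈ L, GDD K h k) :
    GDD K (g * h) l := by
  have := Dec.inflate hh hg
  rw [SimpleGraph.comap_comap] at this
  refine GDD.of_dec (by simp) (fun i => ?_) this
  have e : {x : (Fin l × Fin g) × Fin h // (Prod.fst ∘ Prod.fst) x = i} ≃ Fin g × Fin h :=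
    ⟨fun x => (x.1.1.2, x.1.2), fun y => ⟨((i, y.1), y.2), rfl⟩,
      by rintro ⟨⟨⟨a, b⟩, c⟩, rfl⟩; rfl, by rintro ⟨a, b⟩; rfl⟩
  rw [Nat.card_congr e]
  simp

theorem GDD.of_dec_top {K L : Set ℕ} {h l : ℕ} (hl : Dec L (⊤ : SimpleGraph (Fin l)))
    (hh : ∀ k ∈ L, GDD K h k) : GDD K h l := by
  refine GDD.of_dec (by simp) (fun i => ?_) (Dec.inflate hh hl)
  rw [card_fiber_fst, Nat.card_fin]

theorem Nat.card_finset_mem_mem {V : Type*} [Fintype V] [DecidableEq V] {k : ℕ} (hk : 2 ≤ k)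
    {x y : V} (hxy : x ≠ y) :
    Nat.card {B : Finset V // B.card = k ∧ x ∈ B ∧ y ∈ B} =
      (Fintype.card V - 2).choose (k - 2) := by
  have hc : (Finset.univ \ {x, y} : Finset V).card = Fintype.card V - 2 := by
    rw [Finset.card_sdiff_of_subset (Finset.subset_univ _), Finset.card_pair hxy, Finset.card_univ]
  rw [← hc, ← Finset.card_powersetCard, ← Nat.card_eq_finsetCard]
  refine Nat.card_congr ⟨fun B => ⟨B.1 \ {x, y}, ?_⟩, fun B => ⟨B.1 ∪ {x, y}, ?_⟩, ?_, ?_⟩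
  · obtain ⟨B, hB, hx, hy⟩ := B
    rw [Finset.mem_powersetCard]
    refine ⟨Finset.sdiff_subset_sdiff (Finset.subset_univ _) le_rfl, ?_⟩
    rw [Finset.card_sdiff_of_subset (by simp [Finset.insert_subset_iff, hx, hy]),
      Finset.card_pair hxy, hB]
  · obtain ⟨B, hB⟩ := B
    rw [Finset.mem_powersetCard] at hB
    refine ⟨?_, by simp, by simp⟩
    rw [Finset.card_union_of_disjoint, hB.2, Finset.card_pair hxy]
    · omega
    · exact (Finset.subset_sdiff.1 hB.1).2
  · rintro ⟨B, hB, hx, hy⟩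
    refine Subtype.ext (Finset.sdiff_union_of_subset ?_)
    simp [Finset.insert_subset_iff, hx, hy]
  · rintro ⟨B, hB⟩
    rw [Finset.mem_powersetCard] at hB
    exact Subtype.ext (Finset.union_sdiff_cancel_right (Finset.subset_sdiff.1 hB.1).2)

theorem HasBIBD.complete {k l : ℕ} (hk : 2 ≤ k) (n : ℕ) :
    HasBIBD {k} l (n * (l - 2).choose (k - 2)) := by
  classical
  refine ⟨Fin n × {B : Finset (Fin l) // B.card = k}, inferInstance, fun i => i.2.1,
    fun i => i.2.2, fun y y' hy => ?_⟩
  have := Nat.card_finset_mem_mem hk hy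
  rw [Fintype.card_fin] at this
  rw [← this, ← Nat.card_fin n, ← Nat.card_prod, Nat.card_fin n]
  exact Nat.card_congr ⟨fun i => (i.1.1, ⟨i.1.2.1, i.1.2.2, i.2⟩),
    fun i => ⟨(i.1, ⟨i.2.1, i.2.2.1⟩), i.2.2.2⟩, fun _ => rfl, fun _ => rfl⟩

theorem HasUD.pow {c n : ℕ} (h : HasUD c n) (r : ℕ) : HasUD c (n ^ r) := by
  induction r with
  | zero => simpa using HasUD.one c
  | succ r ih => rw [pow_succ]; exact ih.mul h

theorem HasUD.self_pow {c n : ℕ} (hn : n ≠ 0) : HasUD c (n ^ c) := by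
  refine HasUD.of_factorization (pow_ne_zero _ hn) (fun p hp hpn => ?_)
  have h1 : 1 ≤ n.factorization p :=
    (hp.dvd_iff_one_le_factorization hn).1 (hp.dvd_of_dvd_pow hpn)
  rw [Nat.factorization_pow]
  calc c ≤ p ^ c := (Nat.lt_pow_self hp.one_lt).le
    _ ≤ _ := Nat.pow_le_pow_right hp.pos (by simpa using Nat.le_mul_of_pos_right c h1)

theorem exists_gdd_singleton {k : ℕ} (hk : 2 ≤ k) :
    ∃ M u₀, 0 < M ∧ ∀ u, u₀ ≤ u → GDD {k} M u := by
  obtain ⟨q, u₀, hq⟩ := exists_dec_Icc (m := k) (by omega)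
  set D := ∏ l ∈ Finset.Icc k q, (l - 2).choose (k - 2) with hD
  have hD0 : D ≠ 0 := by
    rw [hD, Finset.prod_ne_zero_iff]
    intro l hl
    rw [Finset.mem_Icc] at hl
    exact (Nat.choose_pos (by omega)).ne'
  have hUD : HasUD (q + k + 1) (D ^ (q + k + 1)) := HasUD.self_pow hD0
  obtain ⟨E, _, _, hE, μ, hμ⟩ := id hUD
  have hEpos : 0 < Nat.card E := by rw [hE]; positivity
  refine ⟨Nat.card E ^ (q + 1), u₀, by positivity, fun u hu => GDD.of_dec_top (hq u hu) ?_⟩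
  rintro l ⟨hl1, hl2⟩
  have hdvd : (l - 2).choose (k - 2) ∣ Nat.card E := by
    rw [hE]
    have : (l - 2).choose (k - 2) ∣ D :=
      Finset.dvd_prod_of_mem (fun l => (l - 2).choose (k - 2)) (Finset.mem_Icc.2 ⟨hl1, hl2⟩)
    exact this.trans (dvd_pow_self D (by omega))
  obtain ⟨n, hn⟩ := hdvd
  have hB : HasBIBD {k} l (Nat.card E) := by
    rw [hn, mul_comm]
    exact HasBIBD.complete hk n
  let e : Option (Fin l) → Fin (q + k + 1) := fun o =>
    Fin.castLE (by omega) ((finSuccEquiv l).symm o)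
  have he : Function.Injective e :=
    (Fin.castLE_injective _).comp (finSuccEquiv l).symm.injective
  have h1 := hB.gdd (μ ∘ e) (fun i j hij => hμ _ _ (he.ne hij))
  have h2 := h1.mul (K := {k}) (h := Nat.card E ^ (q - l)) (by
    rintro _ rfl
    rw [hE]
    exact (hUD.pow _).gdd (by omega))
  rw [← pow_add] at h2
  convert h2 using 2
  omega

/-- The adjacency matrix of the complete graph on `S`. -/
def cliqueMatrix {V : Type*} [DecidableEq V] (S : Finset V) : V → V → ℤ :=
  fun x y => if x ≠ y ∧ x ∈ S ∧ y ∈ S then 1 else 0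

theorem cliqueMatrix_insert {V : Type*} [DecidableEq V] {S : Finset V} {a : V} (ha : a ∉ S) :
    cliqueMatrix (insert a S) = cliqueMatrix S + ∑ x ∈ S, cliqueMatrix {a, x} := by
  ext x y
  simp only [Pi.add_apply, Finset.sum_apply, cliqueMatrix, Finset.mem_insert,
    Finset.mem_singleton]
  by_cases hxy : x = y
  · simp [hxy]
  by_cases hx : x = a
  · subst hx
    have : ∀ z ∈ S, (if x ≠ y ∧ (x = x ∨ x = z) ∧ (y = x ∨ y = z) then (1 : ℤ) else 0) =
        if y = z then 1 else 0 := by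
      intro z _
      simp [hxy, Ne.symm hxy]
    rw [Finset.sum_congr rfl this]
    simp [hxy, Ne.symm hxy, ha]
  by_cases hy : y = a
  · subst hy
    have : ∀ z ∈ S, (if x ≠ y ∧ (x = y ∨ x = z) ∧ (y = y ∨ y = z) then (1 : ℤ) else 0) =
        if x = z then 1 else 0 := by
      intro z _
      simp [hxy]
    rw [Finset.sum_congr rfl this]
    simp [hxy, ha]
  · have : ∀ z ∈ S, (if x ≠ y ∧ (x = a ∨ x = z) ∧ (y = a ∨ y = z) then (1 : ℤ) else 0) = 0 := by
      intro z _
      rw [if_neg]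
      rintro ⟨-, h1, h2⟩
      exact hxy ((h1.resolve_left hx).trans (h2.resolve_left hy).symm)
    rw [Finset.sum_congr rfl this]
    simp [hxy, hx, hy]

/-- A homomorphism killing the matrices of all `k`-subsets is, on pairs, the sum of a constant
and a function of the points. -/
theorem exists_pair_formula {V Q : Type*} [Fintype V] [DecidableEq V] [AddCommGroup Q]
    (f : (V → V → ℤ) →+ Q) {k : ℕ} (hk : 2 ≤ k) (hkV : k + 2 ≤ Fintype.card V)
    (hf : ∀ S : Finset V, S.card = k → f (cliqueMatrix S) = 0) :
    ∃ (c₀ : Q) (h : V → Q) (o : V), h o = -c₀ ∧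
      ∀ x y, x ≠ y → f (cliqueMatrix {x, y}) = c₀ + h x + h y := by
  set F : V → V → Q := fun x y => f (cliqueMatrix {x, y}) with hF
  have hsymm : ∀ x y, F x y = F y x := fun x y => by simp only [hF, Finset.pair_comm]
  have hdiff : ∀ S : Finset V, S.card = k - 1 → ∀ a b, a ∉ S → b ∉ S →
      ∑ x ∈ S, F a x = ∑ x ∈ S, F b x := by
    intro S hS a b ha hb
    have h1 := hf (insert a S) (by rw [Finset.card_insert_of_notMem ha]; omega)
    have h2 := hf (insert b S) (by rw [Finset.card_insert_of_notMem hb]; omega)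
    rw [cliqueMatrix_insert ha, map_add, map_sum] at h1
    rw [cliqueMatrix_insert hb, map_add, map_sum] at h2
    exact add_left_cancel (h1.trans h2.symm)
  have hdiff2 : ∀ a b c d, a ≠ c → a ≠ d → b ≠ c → b ≠ d →
      F a c - F b c = F a d - F b d := by
    intro a b c d hac had hbc hbd
    have hT : k - 2 ≤ (Finset.univ \ {a, b, c, d} : Finset V).card := by
      rw [Finset.card_sdiff_of_subset (Finset.subset_univ _), Finset.card_univ]
      have : ({a, b, c, d} : Finset V).card ≤ 4 := Finset.card_le_four
      omega
    obtain ⟨T, hT1, hT2⟩ := Finset.exists_subset_card_eq hT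
    have hn : a ∉ T ∧ b ∉ T ∧ c ∉ T ∧ d ∉ T := by
      refine ⟨?_, ?_, ?_, ?_⟩ <;>
      · intro h
        simpa using hT1 h
    have h1 := hdiff (insert c T) (by rw [Finset.card_insert_of_notMem hn.2.2.1]; omega) a b
      (by simp [hac, hn.1]) (by simp [hbc, hn.2.1])
    have h2 := hdiff (insert d T) (by rw [Finset.card_insert_of_notMem hn.2.2.2]; omega) a b
      (by simp [had, hn.1]) (by simp [hbd, hn.2.1])
    rw [Finset.sum_insert hn.2.2.1, Finset.sum_insert hn.2.2.1] at h1
    rw [Finset.sum_insert hn.2.2.2, Finset.sum_insert hn.2.2.2] at h2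
    have h3 : F a c - F b c = ∑ x ∈ T, F b x - ∑ x ∈ T, F a x := by
      rw [sub_eq_sub_iff_add_eq_add, h1, add_comm]
    have h4 : F a d - F b d = ∑ x ∈ T, F b x - ∑ x ∈ T, F a x := by
      rw [sub_eq_sub_iff_add_eq_add, h2, add_comm]
    rw [h3, h4]
  obtain ⟨o, o₁, o₂, h01, h02, h12⟩ := Fintype.two_lt_card_iff.1
    (show 2 < Fintype.card V by omega)
  set c : V → V → Q := fun x y => F x y - F x o - F y o with hc
  have hcs : ∀ x y, c x y = c y x := fun x y => by simp only [hc, hsymm x y]; abel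
  have hc1 : ∀ x y y', x ≠ o → x ≠ y → x ≠ y' → y ≠ o → y' ≠ o → c x y = c x y' := by
    intro x y y' hx hxy hxy' hy hy'
    have := hdiff2 x o y y' hxy hxy' hy.symm hy'.symm
    simp only [hc, hsymm y o, hsymm y' o]
    rw [sub_right_comm, this, sub_right_comm]
  have hconst : ∀ x y, x ≠ o → y ≠ o → x ≠ y → c x y = c o₁ o₂ := by
    intro x y hx hy hxy
    by_cases h1 : x = o₁
    · subst h1
      exact hc1 x y o₂ hx hxy h12 hy h02.symm
    · rw [hc1 x y o₁ hx hxy h1 hy h01.symm, hcs]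
      exact hc1 o₁ x o₂ h01.symm (Ne.symm h1) h12 hx h02.symm
  refine ⟨c o₁ o₂, fun x => if x = o then - c o₁ o₂ else F x o, o, by simp, fun x y hxy => ?_⟩
  change F x y = _
  by_cases hx : x = o
  · subst hx
    simp only [if_true, Ne.symm hxy, if_false]
    rw [hsymm]
    abel
  · by_cases hy : y = o
    · subst hy
      simp only [if_true, hxy, if_false]
      abel
    · simp only [hx, hy, if_false]
      rw [← hconst x y hx hy hxy]
      simp only [hc]
      abel

theorem map_cliqueMatrix {V Q : Type*} [DecidableEq V] [AddCommGroup Q]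
    (f : (V → V → ℤ) →+ Q) (c₀ : Q) (h : V → Q)
    (hf : ∀ x y, x ≠ y → f (cliqueMatrix {x, y}) = c₀ + h x + h y) (S : Finset V) :
    f (cliqueMatrix S) = S.card.choose 2 • c₀ + ((S.card : ℤ) - 1) • ∑ x ∈ S, h x := by
  induction S using Finset.induction_on with
  | empty =>
    have : cliqueMatrix (∅ : Finset V) = 0 := by
      ext x y
      simp [cliqueMatrix]
    simp [this]
  | insert a S ha ih =>
    rw [cliqueMatrix_insert ha, map_add, map_sum, ih, Finset.card_insert_of_notMem ha,
      Finset.sum_congr rfl (fun x hx => hf a x (fun h => ha (h ▸ hx))), Finset.sum_insert ha,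
      Finset.sum_add_distrib, Finset.sum_const, Nat.choose_succ_succ' S.card 1,
      Nat.choose_one_right]
    push_cast
    module

theorem SetGcdDvd.zsmul_eq_zero {Q : Type*} [AddCommGroup Q] {S : Set ℤ} {m : ℤ} {x : Q}
    (h : SetGcdDvd S m) (hS : ∀ s ∈ S, s • x = 0) : m • x = 0 := by
  induction h using AddSubgroup.closure_induction with
  | mem s hs => exact hS s hs
  | zero => simp
  | add a b _ _ ha hb => rw [add_smul, ha, hb, add_zero]
  | neg a _ ha => rw [neg_smul, ha, neg_zero]

theorem map_cliqueMatrix_univ {V Q : Type*} [Fintype V] [DecidableEq V] [AddCommGroup Q]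
    (f : (V → V → ℤ) →+ Q) {K : Finset ℕ} (hK : K.Nonempty)
    (hKV : ∀ k ∈ K, 2 ≤ k ∧ k + 2 ≤ Fintype.card V) (hadm : Admissible K (Fintype.card V))
    (hf : ∀ S : Finset V, S.card ∈ K → f (cliqueMatrix S) = 0) :
    f (cliqueMatrix Finset.univ) = 0 := by
  obtain ⟨k₀, hk₀⟩ := hK
  obtain ⟨c₀, h, o, ho, hF⟩ := exists_pair_formula f (hKV k₀ hk₀).1 (hKV k₀ hk₀).2
    (fun S hS => hf S (hS ▸ hk₀))
  have hform := map_cliqueMatrix f c₀ h hF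
  have hdiff : ∀ k ∈ K, ∀ a, ((k : ℤ) - 1) • (h a - h o) = 0 := by
    intro k hk a
    obtain ⟨hk1, hk2⟩ := hKV k hk
    rcases eq_or_ne a o with rfl | hao
    · simp
    have hT : k - 1 ≤ (Finset.univ \ {a, o} : Finset V).card := by
      rw [Finset.card_sdiff_of_subset (Finset.subset_univ _), Finset.card_univ]
      have : ({a, o} : Finset V).card ≤ 2 := Finset.card_le_two
      omega
    obtain ⟨T, hT1, hT2⟩ := Finset.exists_subset_card_eq hT
    have ha : a ∉ T := fun h => by simpa using hT1 h
    have ho' : o ∉ T := fun h => by simpa using hT1 h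
    have hca : (insert a T).card = k := by rw [Finset.card_insert_of_notMem ha]; omega
    have hco : (insert o T).card = k := by rw [Finset.card_insert_of_notMem ho']; omega
    have h1 := hf (insert a T) (by rwa [hca])
    have h2 := hf (insert o T) (by rwa [hco])
    rw [hform, hca, Finset.sum_insert ha] at h1
    rw [hform, hco, Finset.sum_insert ho'] at h2
    have h3 := h1.trans h2.symm
    rw [add_right_inj, smul_add, smul_add, add_left_inj] at h3
    rw [smul_sub, h3, sub_self]
  have hsum : ∀ S : Finset V, (∀ a, ((S.card : ℤ) - 1) • (h a - h o) = 0) →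
      f (cliqueMatrix S) = - (S.card.choose 2 • c₀) := by
    intro S hS
    have h1 : ((S.card : ℤ) - 1) • ∑ x ∈ S, h x = -((S.card * ((S.card : ℤ) - 1)) • c₀) := by
      rw [Finset.smul_sum, Finset.sum_congr rfl (fun a _ => show ((S.card : ℤ) - 1) • h a =
        ((S.card : ℤ) - 1) • h o by rw [← sub_eq_zero, ← smul_sub, hS a]), Finset.sum_const, ho,
        smul_neg, smul_neg, ← natCast_zsmul, smul_smul]
    have h2 : (S.card * ((S.card : ℤ) - 1)) = (2 * S.card.choose 2 : ℕ) := by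
      rw [Nat.choose_two_right, Nat.mul_div_cancel' (Nat.even_mul_pred_self _).two_dvd]
      rcases Nat.eq_zero_or_pos S.card with h | h
      · simp [h]
      · push_cast [Nat.cast_sub h]
        ring
    rw [hform, h1, h2, natCast_zsmul, mul_smul, two_smul]
    abel
  have hc0 : ∀ k ∈ K, k.choose 2 • c₀ = 0 := by
    intro k hk
    obtain ⟨S, -, hS⟩ := Finset.exists_subset_card_eq (s := (Finset.univ : Finset V)) (n := k)
      (by have := (hKV k hk).2; rw [Finset.card_univ]; omega)
    have h1 := hsum S (by rw [hS]; exact hdiff k hk)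
    rw [hf S (hS ▸ hk), hS] at h1
    exact neg_eq_zero.1 h1.symm
  rw [hsum Finset.univ, neg_eq_zero, Finset.card_univ]
  · have hcl : ∀ n ∈ AddSubgroup.closure ((fun k : ℕ => (k : ℤ) * ((k : ℤ) - 1)) '' K),
        ∃ m : ℤ, n = 2 * m ∧ m • c₀ = 0 := by
      intro n hn
      induction hn using AddSubgroup.closure_induction with
      | mem s hs =>
        obtain ⟨k, hk, rfl⟩ := hs
        refine ⟨k.choose 2, ?_, by rw [natCast_zsmul]; exact hc0 k hk⟩
        have h2 : 2 * k.choose 2 = k * (k - 1) := by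
          rw [Nat.choose_two_right, Nat.mul_div_cancel' (Nat.even_mul_pred_self _).two_dvd]
        have h3 := (hKV k hk).1
        zify [show 1 ≤ k by omega] at h2
        exact h2.symm
      | zero => exact ⟨0, by simp⟩
      | add a b _ _ ha hb =>
        obtain ⟨m, rfl, hm⟩ := ha
        obtain ⟨n, rfl, hn⟩ := hb
        exact ⟨m + n, by ring, by rw [add_smul, hm, hn, add_zero]⟩
      | neg a _ ha =>
        obtain ⟨m, rfl, hm⟩ := ha
        exact ⟨-m, by ring, by rw [neg_smul, hm, neg_zero]⟩
    obtain ⟨m, hm1, hm2⟩ := hcl _ hadm.2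
    have h2 : 2 * (Fintype.card V).choose 2 = Fintype.card V * (Fintype.card V - 1) := by
      rw [Nat.choose_two_right, Nat.mul_div_cancel' (Nat.even_mul_pred_self _).two_dvd]
    have h3 := (hKV k₀ hk₀).2
    zify [show 1 ≤ Fintype.card V by omega] at h2
    rw [← natCast_zsmul, show ((Fintype.card V).choose 2 : ℤ) = m by omega]
    exact hm2
  · intro a
    rw [Finset.card_univ]
    refine SetGcdDvd.zsmul_eq_zero hadm.1 ?_
    rintro _ ⟨k, hk, rfl⟩
    exact hdiff k hk a

theorem exists_hasBIBD {K : Finset ℕ} (hK : K.Nonempty) {w : ℕ}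
    (hKw : ∀ k ∈ K, 2 ≤ k ∧ k + 2 ≤ w) (hadm : Admissible K w) :
    ∃ N, ∀ lam, N ≤ lam → HasBIBD K w lam := by
  classical
  let ι := {S : Finset (Fin w) // S.card ∈ K}
  let Λ := Submodule.span ℤ (Set.range (fun S : ι => cliqueMatrix S.1))
  have huniv : cliqueMatrix (Finset.univ : Finset (Fin w)) ∈ Λ := by
    rw [← Submodule.Quotient.mk_eq_zero]
    refine map_cliqueMatrix_univ Λ.mkQ.toAddMonoidHom hK (by simpa using hKw) (by simpa using hadm)
      (fun S hS => ?_)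
    exact (Submodule.Quotient.mk_eq_zero Λ).2 (Submodule.subset_span ⟨⟨S, hS⟩, rfl⟩)
  obtain ⟨c, hc⟩ := (Submodule.mem_span_range_iff_exists_fun ℤ).1 huniv
  have hc1 : ∀ y y', y ≠ y' → ∑ S : ι, c S * (if y ∈ S.1 ∧ y' ∈ S.1 then 1 else 0) = 1 := by
    intro y y' hy
    have := congrFun (congrFun hc y) y'
    simpa [cliqueMatrix, hy, Finset.sum_apply] using this
  set lam₀ := ∑ k ∈ K, (w - 2).choose (k - 2) with hlam₀
  have hpos : 0 < lam₀ := by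
    obtain ⟨k, hk⟩ := hK
    refine Finset.sum_pos (fun k hk => Nat.choose_pos ?_) ⟨k, hk⟩
    have := hKw k hk
    omega
  have hall : ∀ y y' : Fin w, y ≠ y' →
      ∑ S : ι, (if y ∈ S.1 ∧ y' ∈ S.1 then (1 : ℤ) else 0) = lam₀ := by
    intro y y' hy
    have h1 : ∀ k ∈ K, ((w - 2).choose (k - 2) : ℤ) =
        ∑ S : Finset (Fin w), if S.card = k ∧ y ∈ S ∧ y' ∈ S then 1 else 0 := by
      intro k hk
      have := Nat.card_finset_mem_mem (hKw k hk).1 hy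
      rw [Fintype.card_fin] at this
      rw [← this, Nat.card_eq_fintype_card, Fintype.card_subtype]
      simp
    rw [hlam₀, Nat.cast_sum, Finset.sum_congr rfl h1, Finset.sum_comm,
      ← Finset.sum_subtype (Finset.univ.filter fun S : Finset (Fin w) => S.card ∈ K) (by simp)
        (fun S => if y ∈ S ∧ y' ∈ S then (1 : ℤ) else 0), Finset.sum_filter]
    refine Finset.sum_congr rfl (fun S _ => ?_)
    by_cases h : y ∈ S ∧ y' ∈ S <;> simp [h]
  set N := ∑ S : ι, (c S).natAbs with hN
  refine ⟨lam₀ * (lam₀ * N), fun lam hlam => ?_⟩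
  set q := lam / lam₀
  set r := lam % lam₀
  have hqr : lam₀ * q + r = lam := Nat.div_add_mod _ _
  have hr : r < lam₀ := Nat.mod_lt _ hpos
  have hq : lam₀ * N ≤ q := (Nat.le_div_iff_mul_le hpos).2 (by linarith)
  have hm : ∀ S, 0 ≤ (q : ℤ) + r * c S := by
    intro S
    have h1 : (c S).natAbs ≤ N :=
      Finset.single_le_sum (f := fun S => (c S).natAbs) (fun _ _ => Nat.zero_le _)
        (Finset.mem_univ S)
    have h2 : r * (c S).natAbs ≤ q := (Nat.mul_le_mul hr.le h1).trans hq
    have h3 : -((c S).natAbs : ℤ) ≤ c S := by omega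
    zify at h2
    have h4 : (r : ℤ) * -|c S| ≤ r * c S := by
      refine mul_le_mul_of_nonneg_left ?_ (by positivity)
      exact neg_abs_le _
    rw [← Int.natCast_natAbs] at h4
    push_cast at *
    linarith
  refine ⟨Σ S : ι, Fin ((q : ℤ) + r * c S).toNat, inferInstance, fun i => i.1.1,
    fun i => i.1.2, fun y y' hy => ?_⟩
  have h1 : Nat.card {i : Σ S : ι, Fin ((q : ℤ) + r * c S).toNat // y ∈ i.1.1 ∧ y' ∈ i.1.1} =
      ∑ S : ι, if y ∈ S.1 ∧ y' ∈ S.1 then ((q : ℤ) + r * c S).toNat else 0 := by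
    rw [Nat.card_eq_fintype_card, Fintype.card_subtype, Finset.card_filter, Fintype.sum_sigma]
    refine Finset.sum_congr rfl (fun S _ => ?_)
    by_cases h : y ∈ S.1 ∧ y' ∈ S.1 <;> simp [h]
  rw [h1]
  zify
  have h2 : ∀ S : ι, ((if y ∈ S.1 ∧ y' ∈ S.1 then ((q : ℤ) + r * c S).toNat else 0 : ℕ) : ℤ) =
      q * (if y ∈ S.1 ∧ y' ∈ S.1 then 1 else 0) +
      r * (c S * (if y ∈ S.1 ∧ y' ∈ S.1 then 1 else 0)) := by
    intro S
    by_cases h : y ∈ S.1 ∧ y' ∈ S.1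
    · simp [h, hm S]
    · simp [h]
  have h3 : ((∑ S : ι, if y ∈ S.1 ∧ y' ∈ S.1 then ((q : ℤ) + r * c S).toNat else 0 : ℕ) : ℤ) =
      lam := by
    rw [Nat.cast_sum, Finset.sum_congr rfl (fun S _ => h2 S), Finset.sum_add_distrib,
      ← Finset.mul_sum, ← Finset.mul_sum, hall y y' hy, hc1 y y' hy, ← hqr]
    push_cast
    ring
  exact_mod_cast h3

/-- Few elements `x` have few power residues of a given class in `x - A`. -/
theorem card_bad_le {F : Type*} [Field F] [Fintype F] [DecidableEq F] {e m : ℕ} (he : 0 < e)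
    (hm : 0 < m) (hem : e * m = Fintype.card F - 1) (A : Finset F) {c : F} (hc : c ^ e = 1) :
    (Finset.univ.filter fun x : F =>
      2 * e * (A.filter fun a => (x - a) ^ m = c).card < A.card).card * A.card ≤
        4 * e ^ 2 * Fintype.card F := by
  set q := Fintype.card F with hq
  have hq1 : 1 < q := Fintype.one_lt_card
  set C : Finset F := Finset.univ.filter fun c => c ^ e = 1 with hC
  set N : F → F → ℕ := fun c x => (A.filter fun a => (x - a) ^ m = c).card with hN
  have hroots : ∀ n : ℕ, 0 < n → (Finset.univ.filter fun y : F => y ^ n = 1).card ≤ n := by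
    intro n hn
    refine le_trans (Finset.card_le_card (t := (Polynomial.nthRoots n (1 : F)).toFinset) ?_)
      ((Multiset.toFinset_card_le _).trans (Polynomial.card_nthRoots n 1))
    intro y hy
    simpa [Polynomial.mem_nthRoots hn] using hy
  have hCe : C.card ≤ e := hroots e he
  have hpow : ∀ y : F, y ≠ 0 → y ^ m ∈ C := by
    intro y hy
    rw [hC, Finset.mem_filter, ← pow_mul, mul_comm, hem]
    exact ⟨Finset.mem_univ _, FiniteField.pow_card_sub_one_eq_one y hy⟩
  have hC0 : (0 : F) ∉ C := by simp [hC, he.ne']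
  have h1 : ∀ x, ∑ c ∈ C, N c x = (A.filter fun a => a ≠ x).card := by
    intro x
    rw [Finset.card_eq_sum_card_fiberwise (f := fun a => (x - a) ^ m) (t := C)]
    · refine Finset.sum_congr rfl (fun c hc => ?_)
      rw [Finset.filter_filter]
      refine congrArg Finset.card (Finset.ext fun a => ?_)
      simp only [Finset.mem_filter]
      constructor
      · rintro ⟨ha, rfl⟩
        refine ⟨ha, ?_, rfl⟩
        rintro rfl
        exact hC0 (by simpa [hm.ne'] using hc)
      · exact fun h => ⟨h.1, h.2.2⟩
    · intro a ha
      rw [Finset.mem_coe, Finset.mem_filter] at ha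
      exact hpow _ (sub_ne_zero.2 ha.2.symm)
  have hcol : ∀ a, (Finset.univ.filter fun x : F => a ≠ x).card = q - 1 := by
    intro a
    rw [Finset.filter_ne, Finset.card_erase_of_mem (Finset.mem_univ _), Finset.card_univ]
  have hsum1 : ∑ x, ∑ c ∈ C, N c x = A.card * (q - 1) := by
    simp only [h1, Finset.card_filter]
    rw [Finset.sum_comm]
    simp only [← Finset.card_filter, hcol]
    simp
  have hpair : ∀ a b, a ≠ b →
      (Finset.univ.filter fun x : F => a ≠ x ∧ (x - a) ^ m = (x - b) ^ m).card ≤ m - 1 := by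
    intro a b hab
    have h2 : ((Finset.univ.filter fun y : F => y ^ m = 1).erase 1).card ≤ m - 1 := by
      rw [Finset.card_erase_of_mem (by simp)]
      exact Nat.sub_le_sub_right (hroots m hm) 1
    refine le_trans (Finset.card_le_card_of_injOn (fun x => (x - a) / (x - b)) ?_ ?_) h2
    · intro x hx
      simp only [Finset.coe_filter, Finset.mem_univ, true_and, Set.mem_ofPred_eq] at hx
      have hxb : x - b ≠ 0 := by
        intro h
        rw [h, zero_pow hm.ne', pow_eq_zero_iff hm.ne', sub_eq_zero] at hx
        exact hx.1 hx.2.symm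
      simp only [Finset.coe_erase, Finset.coe_filter, Finset.mem_univ, true_and, Set.mem_sdiff,
        Set.mem_ofPred_eq, Set.mem_singleton_iff]
      refine ⟨?_, ?_⟩
      · rw [div_pow, hx.2, div_self (pow_ne_zero _ hxb)]
      · rw [div_eq_one_iff_eq hxb]
        exact fun h => hab (by simpa using h)
    · intro x hx y hy hxy
      simp only [Finset.coe_filter, Finset.mem_univ, true_and, Set.mem_ofPred_eq] at hx hy
      have hxb : x - b ≠ 0 := by
        intro h
        rw [h, zero_pow hm.ne', pow_eq_zero_iff hm.ne', sub_eq_zero] at hx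
        exact hx.1 hx.2.symm
      have hyb : y - b ≠ 0 := by
        intro h
        rw [h, zero_pow hm.ne', pow_eq_zero_iff hm.ne', sub_eq_zero] at hy
        exact hy.1 hy.2.symm
      dsimp only at hxy
      rw [div_eq_div_iff hxb hyb] at hxy
      have : (a - b) * (x - y) = 0 := by linear_combination hxy
      rcases mul_eq_zero.1 this with h | h
      · exact (hab (sub_eq_zero.1 h)).elim
      · exact sub_eq_zero.1 h
  have hsq : ∀ x, ∑ c ∈ C, N c x ^ 2 =
      ∑ a ∈ A, ∑ b ∈ A, if a ≠ x ∧ (x - a) ^ m = (x - b) ^ m then 1 else 0 := by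
    intro x
    have : ∀ c, N c x ^ 2 = ∑ a ∈ A, ∑ b ∈ A,
        if (x - a) ^ m = c ∧ (x - b) ^ m = c then 1 else 0 := by
      intro c
      rw [sq]
      simp only [hN, Finset.card_filter, Finset.sum_mul_sum]
      refine Finset.sum_congr rfl (fun a _ => Finset.sum_congr rfl (fun b _ => ?_))
      by_cases h1 : (x - a) ^ m = c <;> by_cases h2 : (x - b) ^ m = c <;> simp [h1, h2]
    simp only [this]
    rw [Finset.sum_comm]
    refine Finset.sum_congr rfl (fun a _ => ?_)
    rw [Finset.sum_comm]
    refine Finset.sum_congr rfl (fun b _ => ?_)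
    by_cases h : a ≠ x ∧ (x - a) ^ m = (x - b) ^ m
    · rw [if_pos h, Finset.sum_eq_single ((x - a) ^ m)]
      · simp [h.2]
      · intro c _ hc
        rw [if_neg (fun h' => hc h'.1.symm)]
      · intro h'
        exact (h' (hpow _ (sub_ne_zero.2 h.1.symm))).elim
    · rw [if_neg h]
      refine Finset.sum_eq_zero (fun c hc => if_neg ?_)
      rintro ⟨rfl, h2⟩
      refine h ⟨?_, h2.symm⟩
      rintro rfl
      exact hC0 (by simpa [hm.ne'] using hc)
  have hsum2 : ∑ x, ∑ c ∈ C, N c x ^ 2 ≤ A.card * ((q - 1) + (A.card - 1) * (m - 1)) := by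
    simp only [hsq]
    rw [Finset.sum_comm, ← smul_eq_mul]
    refine Finset.sum_le_card_nsmul _ _ _ (fun a ha => ?_)
    rw [Finset.sum_comm, ← Finset.add_sum_erase _ _ ha]
    refine add_le_add ?_ ?_
    · simp only [and_true, ← Finset.card_filter, hcol]
      exact le_rfl
    · rw [← Finset.card_erase_of_mem ha, ← smul_eq_mul]
      refine Finset.sum_le_card_nsmul _ _ _ (fun b hb => ?_)
      rw [← Finset.card_filter]
      exact hpair a b (Finset.ne_of_mem_erase hb).symm
  have hvar : ∑ x, ∑ c ∈ C, ((e : ℤ) * N c x - A.card) ^ 2 ≤ e ^ 2 * A.card * q := by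
    rcases Nat.eq_zero_or_pos A.card with hA | hA
    · have : ∀ c x, N c x = 0 := fun c x =>
        Nat.le_zero.1 ((Finset.card_filter_le _ _).trans hA.le)
      simp [this, hA]
    have hexp : ∑ x, ∑ c ∈ C, ((e : ℤ) * N c x - A.card) ^ 2 =
        e ^ 2 * (∑ x, ∑ c ∈ C, N c x ^ 2 : ℕ) - 2 * e * A.card * (∑ x, ∑ c ∈ C, N c x : ℕ)
          + q * (C.card * (A.card : ℤ) ^ 2) := by
      push_cast
      simp only [sub_sq, mul_pow, Finset.sum_add_distrib, Finset.sum_sub_distrib,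
        Finset.mul_sum, Finset.sum_const, nsmul_eq_mul, Finset.card_univ]
      congr 1
      congr 1
      refine Finset.sum_congr rfl (fun x _ => Finset.sum_congr rfl (fun c _ => ?_))
      ring
    rw [hexp, hsum1]
    have hq' : ((q - 1 : ℕ) : ℤ) = e * m := by exact_mod_cast hem.symm
    have hqq : (q : ℤ) = e * m + 1 := by omega
    have h3 : ((∑ x, ∑ c ∈ C, N c x ^ 2 : ℕ) : ℤ) ≤
        A.card * (e * m + (A.card - 1) * (m - 1)) := by
      refine (Nat.cast_le.2 hsum2).trans (le_of_eq ?_)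
      push_cast [hq', Nat.cast_sub (show 1 ≤ A.card from hA), Nat.cast_sub (show 1 ≤ m from hm)]
      ring
    have h4 : (C.card : ℤ) ≤ e := by exact_mod_cast hCe
    have h5 : (e : ℤ) ^ 2 * (∑ x, ∑ c ∈ C, N c x ^ 2 : ℕ) ≤
        e ^ 2 * (A.card * (e * m + (A.card - 1) * (m - 1))) :=
      mul_le_mul_of_nonneg_left h3 (by positivity)
    have h6 : (q : ℤ) * (C.card * (A.card : ℤ) ^ 2) ≤ q * (e * (A.card : ℤ) ^ 2) :=
      mul_le_mul_of_nonneg_left (mul_le_mul_of_nonneg_right h4 (by positivity)) (by positivity)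
    have he' : (1 : ℤ) ≤ e := by exact_mod_cast he
    have hm' : (1 : ℤ) ≤ m := by exact_mod_cast hm
    have hA' : (1 : ℤ) ≤ A.card := by exact_mod_cast hA
    push_cast at h5 ⊢
    rw [hq']
    rw [hqq] at h6 ⊢
    have h7 : 0 ≤ (e : ℤ) * (e - 1) * A.card ^ 2 := by
      have : 0 ≤ (e : ℤ) - 1 := by linarith
      positivity
    have h8 : 0 ≤ (e : ℤ) ^ 2 * A.card * (m - 1) := by
      have : 0 ≤ (m : ℤ) - 1 := by linarith
      positivity
    have h9 : 0 ≤ (e : ℤ) ^ 2 * A.card := by positivity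
    nlinarith
  set bad := Finset.univ.filter fun x : F => 2 * e * N c x < A.card with hbad
  have hcC : c ∈ C := by simp [hC, hc]
  have h10 : (bad.card : ℤ) * (A.card : ℤ) ^ 2 ≤ 4 * (e ^ 2 * A.card * q) := by
    calc (bad.card : ℤ) * (A.card : ℤ) ^ 2
        ≤ ∑ x ∈ bad, 4 * ((e : ℤ) * N c x - A.card) ^ 2 := by
          rw [← nsmul_eq_mul]
          refine Finset.card_nsmul_le_sum _ _ _ (fun x hx => ?_)
          have : 2 * (e : ℤ) * N c x < A.card := by
            exact_mod_cast (Finset.mem_filter.1 hx).2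
          have h0 : 0 ≤ (e : ℤ) * N c x := by positivity
          nlinarith
      _ ≤ ∑ x ∈ bad, 4 * ∑ c ∈ C, ((e : ℤ) * N c x - A.card) ^ 2 := by
          refine Finset.sum_le_sum (fun x _ => ?_)
          refine mul_le_mul_of_nonneg_left ?_ (by norm_num)
          exact Finset.single_le_sum (f := fun c => ((e : ℤ) * N c x - A.card) ^ 2)
            (fun _ _ => sq_nonneg _) hcC
      _ ≤ ∑ x, 4 * ∑ c ∈ C, ((e : ℤ) * N c x - A.card) ^ 2 :=
          Finset.sum_le_sum_of_subset_of_nonneg (Finset.subset_univ _)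
            (fun x _ _ => mul_nonneg (by norm_num) (Finset.sum_nonneg fun _ _ => sq_nonneg _))
      _ ≤ _ := by
          rw [← Finset.mul_sum]
          exact mul_le_mul_of_nonneg_left hvar (by norm_num)
  rcases Nat.eq_zero_or_pos A.card with hA | hA
  · rw [hA]
    simp
  · have hA' : (0 : ℤ) < A.card := by exact_mod_cast hA
    have : (bad.card : ℤ) * A.card ≤ 4 * e ^ 2 * q := by
      refine le_of_mul_le_mul_right ?_ hA'
      linarith
    exact_mod_cast this

theorem exists_pow_sub_eq (e : ℕ) (he : 0 < e) (k : ℕ) : ∀ D : ℕ, ∃ q₀ : ℕ,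
    ∀ (F : Type) [Field F] [Fintype F] (m : ℕ), 0 < m → e * m = Fintype.card F - 1 →
      q₀ ≤ Fintype.card F → ∀ c : Fin k → Fin k → F, (∀ i j, i < j → c i j ^ e = 1) →
        ∀ A : Fin k → Finset F, (∀ i, Fintype.card F ≤ D * (A i).card) →
          ∃ a : Fin k → F, (∀ i, a i ∈ A i) ∧ ∀ i j, i < j → (a i - a j) ^ m = c i j := by
  induction k with
  | zero => exact fun D => ⟨0, fun F _ _ m _ _ _ c _ A _ => ⟨Fin.elim0, fun i => i.elim0,
      fun i => i.elim0⟩⟩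
  | succ k ih =>
    intro D
    obtain ⟨q₁, hq₁⟩ := ih (D * (2 * e))
    refine ⟨max q₁ (D * (k * (4 * e ^ 2 * D)) + 1), fun F _ _ m hm hem hq c hc A hA => ?_⟩
    classical
    have hF : 0 < Fintype.card F := Fintype.card_pos
    set bad : Fin k → Finset F := fun i => Finset.univ.filter fun x : F =>
      2 * e * ((A i.succ).filter fun a => (x - a) ^ m = c 0 i.succ).card < (A i.succ).card
    have hbad : ∀ i, (bad i).card ≤ 4 * e ^ 2 * D := by
      intro i
      have h1 := card_bad_le he hm hem (A i.succ) (hc 0 i.succ (Fin.succ_pos i))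
      have h2 := hA i.succ
      have h3 : 0 < (A i.succ).card := by
        rcases Nat.eq_zero_or_pos (A i.succ).card with h | h
        · rw [h] at h2; omega
        · exact h
      refine Nat.le_of_mul_le_mul_right (h1.trans ?_) h3
      rw [mul_assoc _ D]
      exact Nat.mul_le_mul_left _ h2
    have hlt : (Finset.univ.biUnion bad).card < (A 0).card := by
      have h1 : (Finset.univ.biUnion bad).card ≤ k * (4 * e ^ 2 * D) := by
        refine (Finset.card_biUnion_le_card_mul _ _ _ (fun i _ => hbad i)).trans ?_
        simp
      refine lt_of_le_of_lt h1 ?_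
      have h2 := hA 0
      have h3 := le_max_right q₁ (D * (k * (4 * e ^ 2 * D)) + 1)
      exact Nat.lt_of_mul_lt_mul_left (a := D) (by omega)
    obtain ⟨x, hx, hxb⟩ := Finset.exists_mem_notMem_of_card_lt_card hlt
    obtain ⟨a, ha, hac⟩ := hq₁ F m hm hem ((le_max_left _ _).trans hq)
      (fun i j => c i.succ j.succ) (fun i j hij => hc _ _ (Fin.succ_lt_succ_iff.2 hij))
      (fun i => (A i.succ).filter fun a => (x - a) ^ m = c 0 i.succ) (fun i => by
        have h1 : ¬ (2 * e * ((A i.succ).filter fun a => (x - a) ^ m = c 0 i.succ).card <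
            (A i.succ).card) := fun h => hxb (by
          simp only [Finset.mem_biUnion, Finset.mem_univ, true_and]
          exact ⟨i, by simpa [bad] using h⟩)
        refine (hA i.succ).trans ?_
        rw [mul_assoc]
        exact Nat.mul_le_mul_left _ (not_lt.1 h1))
    refine ⟨Fin.cons x a, ?_, ?_⟩
    · intro i
      refine Fin.cases hx (fun i => ?_) i
      exact (Finset.mem_filter.1 (ha i)).1
    · intro i j
      refine Fin.cases ?_ (fun j => ?_) j
      · exact fun h => (Fin.not_lt_zero _ h).elim
      · refine Fin.cases (fun _ => ?_) (fun i hij => ?_) i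
        · exact (Finset.mem_filter.1 (ha j)).2
        · exact hac i j (Fin.succ_lt_succ_iff.1 hij)

theorem card_pow_eq_one {F : Type*} [Field F] [Fintype F] {e m : ℕ} (he : 0 < e) (hm : 0 < m)
    (hem : e * m = Fintype.card F - 1) : Nat.card {c : F // c ^ e = 1} = e := by
  classical
  have hroots : ∀ n : ℕ, 0 < n → ∀ b : F,
      (Finset.univ.filter fun y : F => y ^ n = b).card ≤ n := by
    intro n hn b
    refine le_trans (Finset.card_le_card (t := (Polynomial.nthRoots n b).toFinset) ?_)
      ((Multiset.toFinset_card_le _).trans (Polynomial.card_nthRoots n b))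
    intro y hy
    simpa [Polynomial.mem_nthRoots hn] using hy
  rw [Nat.card_eq_fintype_card, Fintype.card_subtype]
  refine le_antisymm (hroots e he 1) ?_
  have h1 : (Finset.univ.erase (0 : F)).card ≤
      m * (Finset.univ.filter fun c : F => c ^ e = 1).card := by
    refine Finset.card_le_mul_card_image_of_maps_to (f := fun y => y ^ m) ?_ m ?_
    · intro y hy
      rw [Finset.mem_filter, ← pow_mul, mul_comm, hem,
        FiniteField.pow_card_sub_one_eq_one y (Finset.ne_of_mem_erase hy)]
      exact ⟨Finset.mem_univ _, rfl⟩
    · intro c _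
      exact (Finset.card_le_card (Finset.filter_subset_filter _ (Finset.erase_subset _ _))).trans
        (hroots m hm c)
  rw [Finset.card_erase_of_mem (Finset.mem_univ _), Finset.card_univ, ← hem, mul_comm] at h1
  exact Nat.le_of_mul_le_mul_left h1 hm

/-- Balanced incomplete block designs of large prime order from cyclotomy. -/
theorem exists_dec_prime {k : ℕ} (hk : 2 ≤ k) : ∃ p₀, ∀ p, p.Prime → p₀ ≤ p →
    k * (k - 1) ∣ p - 1 → Dec {k} (⊤ : SimpleGraph (Fin p)) := by
  obtain ⟨e, he2⟩ : ∃ e, 2 * e = k * (k - 1) :=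
    ⟨_, Nat.mul_div_cancel' (Nat.even_mul_pred_self k).two_dvd⟩
  have he : 0 < e := by
    have : 0 < k * (k - 1) := Nat.mul_pos (by omega) (by omega)
    omega
  obtain ⟨q₀, hq₀⟩ := exists_pow_sub_eq e he k 1
  refine ⟨max q₀ 3, fun p hp hpq hdvd => ?_⟩
  have hp3 : 3 ≤ p := (le_max_right _ _).trans hpq
  have : Fact p.Prime := ⟨hp⟩
  obtain ⟨t, ht⟩ := hdvd
  rw [← he2] at ht
  obtain ⟨m, rfl⟩ : ∃ m, m = 2 * t := ⟨_, rfl⟩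
  have hm : 0 < 2 * t := by
    rcases Nat.eq_zero_or_pos t with rfl | h
    · omega
    · omega
  have hem : e * (2 * t) = Fintype.card (ZMod p) - 1 := by
    rw [ZMod.card, ht]; ring
  have hcard : Nat.card (Σ j : Fin k, Fin j) = Nat.card {c : ZMod p // c ^ e = 1} := by
    rw [card_pow_eq_one he hm hem, Nat.card_sigma]
    simp only [Nat.card_eq_fintype_card, Fintype.card_fin]
    have h1 := Finset.sum_range_id_mul_two k
    rw [Fin.sum_univ_eq_sum_range (fun i => i)]
    omega
  set σ := (Finite.card_eq.1 hcard).some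
  obtain ⟨a, -, ha⟩ := hq₀ (ZMod p) (2 * t) hm hem
    (by rw [ZMod.card]; exact (le_max_left _ _).trans hpq)
    (fun i j => if h : i < j then (σ ⟨j, ⟨i, h⟩⟩).1 else 1)
    (fun i j hij => by
      simp only [dif_pos hij]
      exact (σ ⟨j, ⟨i, hij⟩⟩).2)
    (fun _ => Finset.univ) (fun _ => by simp)
  have hsymm : ∀ x y : ZMod p, (x - y) ^ (2 * t) = (y - x) ^ (2 * t) := by
    intro x y
    rw [← neg_sub, Even.neg_pow (even_two_mul t)]
  have hlt : ∀ i j i' j', i < j → i' < j' → (a i - a j) ^ (2 * t) = (a i' - a j') ^ (2 * t) →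
      i = i' ∧ j = j' := by
    intro i j i' j' h h' heq
    rw [ha i j h, ha i' j' h', dif_pos h, dif_pos h'] at heq
    have := σ.injective (Subtype.ext heq)
    simp only [Sigma.mk.injEq] at this
    obtain ⟨rfl, h2⟩ := this
    simp only [heq_eq_eq, Fin.mk.injEq] at h2
    exact ⟨Fin.ext h2, rfl⟩
  have huniq : ∀ i j i' j', i ≠ j → i' ≠ j' →
      (a i - a j) ^ (2 * t) = (a i' - a j') ^ (2 * t) →
      (i = i' ∧ j = j') ∨ (i = j' ∧ j = i') := by
    intro i j i' j' h h' heq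
    rcases lt_or_gt_of_ne h with h | h <;> rcases lt_or_gt_of_ne h' with h' | h'
    · exact Or.inl (hlt _ _ _ _ h h' heq)
    · exact Or.inr (hlt _ _ _ _ h h' (heq.trans (hsymm _ _)))
    · exact Or.inr (hlt _ _ _ _ h h' ((hsymm _ _).trans heq)).symm
    · exact Or.inl (hlt _ _ _ _ h h' (((hsymm _ _).trans heq).trans (hsymm _ _))).symm
  have hone : ∀ x : ZMod p, x ^ (2 * t) ≠ 0 → x ≠ 0 := by
    rintro x hx rfl
    exact hx (zero_pow hm.ne')
  have hex : ∀ d : ZMod p, d ≠ 0 → ∃ i j, i < j ∧ (a i - a j) ^ (2 * t) = d ^ (2 * t) := by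
    intro d hd
    have h1 : (d ^ (2 * t)) ^ e = 1 := by
      rw [← pow_mul, mul_comm, hem, FiniteField.pow_card_sub_one_eq_one d hd]
    obtain ⟨⟨j, i⟩, hij⟩ := σ.surjective ⟨_, h1⟩
    have hlt : (⟨i, i.2.trans j.2⟩ : Fin k) < j := i.2
    refine ⟨⟨i, i.2.trans j.2⟩, j, hlt, ?_⟩
    rw [ha _ _ hlt, dif_pos hlt, hij]
  have hane : ∀ i j, i < j → a i - a j ≠ 0 := by
    intro i j hij
    refine hone _ ?_
    rw [ha i j hij, dif_pos hij]
    intro h0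
    have := (σ ⟨j, ⟨i, hij⟩⟩).2
    rw [h0, zero_pow he.ne'] at this
    exact zero_ne_one this
  have hainj : Function.Injective a := by
    intro i j hij
    by_contra hne
    rcases lt_or_gt_of_ne hne with h | h
    · exact hane _ _ h (sub_eq_zero.2 hij)
    · exact hane _ _ h (sub_eq_zero.2 hij.symm)
  set T : Set (ZMod p) := {h | h ^ (2 * t) = 1 ∧ h.val < (-h).val}
  have hT0 : ∀ h ∈ T, h ≠ 0 := fun h hh => hone _ (by rw [hh.1]; exact one_ne_zero)
  have hdec : Dec {k} (⊤ : SimpleGraph (ZMod p)) := by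
    refine Dec.of_cliques (ι := ZMod p × T)
      (fun u => Set.range fun i => u.1 + u.2.1 * a i) ?_ ?_ ?_ ?_
    · rintro ⟨u, h, hh⟩
      refine Dec.top_of_card ?_
      rw [Set.mem_singleton_iff, Nat.card_range_of_injective, Nat.card_fin]
      intro i j hij
      exact hainj (mul_left_cancel₀ (hT0 h hh) (add_left_cancel hij))
    · intro i x _ y _ hxy
      exact hxy
    · intro x y hxy
      obtain ⟨i, j, hij, h1⟩ := hex (x - y) (sub_ne_zero.2 hxy)
      have h0 := hane i j hij
      set h := (x - y) / (a i - a j) with hh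
      have h2 : h ^ (2 * t) = 1 := by
        rw [hh, div_pow, h1, div_self (pow_ne_zero _ (sub_ne_zero.2 hxy))]
      have h3 : h * (a i - a j) = x - y := div_mul_cancel₀ _ h0
      have h4 : h ≠ 0 := hone _ (by rw [h2]; exact one_ne_zero)
      have h5 : h.val ≠ (-h).val := by
        intro h5
        exact ZMod.ne_neg_self (hp.odd_of_ne_two (by omega)) h4 (ZMod.val_injective p h5)
      rcases lt_or_gt_of_ne h5 with h5 | h5
      · refine ⟨⟨x - h * a i, h, h2, h5⟩, ⟨i, ?_⟩, ⟨j, ?_⟩⟩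
        · simp
        · simp only
          linear_combination -h3
      · refine ⟨⟨x + h * a j, -h, ?_, ?_⟩, ⟨j, ?_⟩, ⟨i, ?_⟩⟩
        · rw [Even.neg_pow (even_two_mul t), h2]
        · simpa using h5
        · simp
        · simp only
          linear_combination -h3
    · rintro x y hxy ⟨u, h, hh⟩ ⟨u', h', hh'⟩ ⟨i, hi⟩ ⟨j, hj⟩ ⟨i', hi'⟩ ⟨j', hj'⟩
      dsimp only at hi hj hi' hj'
      have hne : i ≠ j := by
        rintro rfl
        exact hxy (hi.symm.trans hj)
      have hne' : i' ≠ j' := by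
        rintro rfl
        exact hxy (hi'.symm.trans hj')
      have h1 : h * (a i - a j) = h' * (a i' - a j') := by
        linear_combination hi - hj - hi' + hj'
      have h2 : (a i - a j) ^ (2 * t) = (a i' - a j') ^ (2 * t) := by
        have := congrArg (fun z => z ^ (2 * t)) h1
        simpa [mul_pow, hh.1, hh'.1] using this
      rcases huniq _ _ _ _ hne hne' h2 with ⟨rfl, rfl⟩ | ⟨rfl, rfl⟩
      · obtain rfl : h = h' := mul_right_cancel₀ (sub_ne_zero.2 (fun h => hne (hainj h))) h1
        obtain rfl : u = u' := add_right_cancel (hi.trans hi'.symm)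
        rfl
      · obtain rfl : h = -h' := by
          refine mul_right_cancel₀ (sub_ne_zero.2 (fun h => hne (hainj h))) ?_
          linear_combination h1
        have h3 := hh.2
        rw [neg_neg] at h3
        exact (lt_asymm h3 hh'.2).elim
  exact hdec.top_congr (by simp)

theorem exists_prime_dec {k : ℕ} (hk : 2 ≤ k) {n : ℕ} (hn : n ≠ 0) (b : ℕ) :
    ∃ p, p.Prime ∧ b ≤ p ∧ p ≡ 1 [MOD n] ∧ Dec {k} (⊤ : SimpleGraph (Fin p)) := by
  obtain ⟨p₀, hp₀⟩ := exists_dec_prime hk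
  have hk0 : k * (k - 1) ≠ 0 := Nat.mul_ne_zero (by omega) (by omega)
  obtain ⟨p, hp, hgt, hmod⟩ := Nat.exists_prime_gt_modEq_one (max b p₀) (mul_ne_zero hn hk0)
  refine ⟨p, hp, (le_max_left _ _).trans hgt.le, hmod.of_dvd (dvd_mul_right _ _),
    hp₀ p hp ((le_max_right _ _).trans hgt.le) ?_⟩
  exact (dvd_mul_left _ _).trans ((Nat.modEq_iff_dvd' hp.one_le).1 hmod.symm)

theorem Admissible.add_mul {K : Set ℕ} {k : ℕ} (hk : k ∈ K) {v : ℕ} (hv : Admissible K v) (n : ℕ) :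
    Admissible K (v + n * (k * (k - 1))) := by
  rcases Nat.eq_zero_or_pos k with rfl | hk0
  · simpa using hv
  have hcast : (((k - 1 : ℕ)) : ℤ) = k - 1 := by push_cast [Nat.cast_sub hk0]; ring
  refine ⟨?_, ?_⟩
  · have h1 : (k : ℤ) - 1 ∈ AddSubgroup.closure ((fun k : ℕ => (k : ℤ) - 1) '' K) :=
      AddSubgroup.subset_closure ⟨k, hk, rfl⟩
    have h2 := AddSubgroup.add_mem _ hv.1 (AddSubgroup.zsmul_mem _ h1 (n * k))
    unfold SetGcdDvd
    convert h2 using 1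
    push_cast [hcast]
    ring
  · have h1 : (k : ℤ) * (k - 1) ∈
        AddSubgroup.closure ((fun k : ℕ => (k : ℤ) * ((k : ℤ) - 1)) '' K) :=
      AddSubgroup.subset_closure ⟨k, hk, rfl⟩
    have h2 := AddSubgroup.add_mem _ hv.2
      (AddSubgroup.zsmul_mem _ h1 (n * (2 * v + n * (k * (k - 1)) - 1)))
    unfold SetGcdDvd
    convert h2 using 1
    push_cast [hcast]
    ring

/-- Pairwise balanced designs exist in every residue class of admissible integers. -/
theorem exists_dec_modEq {K : Finset ℕ} (hK : K.Nonempty) (h2 : ∀ k ∈ K, 2 ≤ k) {v : ℕ}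
    (hv : Admissible K v) {N : ℕ} (hN : N ≠ 0) (b : ℕ) :
    ∃ v₁, b ≤ v₁ ∧ v₁ ≡ v [MOD N] ∧ Dec (K : Set ℕ) (⊤ : SimpleGraph (Fin v₁)) := by
  obtain ⟨k, hk⟩ := hK
  have hk0 : k * (k - 1) ≠ 0 := by
    have := h2 k hk
    exact Nat.mul_ne_zero (by omega) (by omega)
  set w := v + ((b + K.sup id + 2) * N) * (k * (k - 1)) with hw
  have hwb : b + K.sup id + 2 ≤ w := by
    rw [hw, mul_assoc]
    exact (Nat.le_mul_of_pos_right _ (Nat.pos_of_ne_zero (mul_ne_zero hN hk0))).trans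
      (Nat.le_add_left _ _)
  have hwmod : w ≡ v [MOD N] := by
    rw [Nat.ModEq, hw, mul_assoc, mul_left_comm, Nat.add_mul_mod_self_left]
  obtain ⟨n, hn⟩ := exists_hasBIBD ⟨k, hk⟩ (w := w) (fun k' hk' => ⟨h2 k' hk', by
    have : k' ≤ K.sup id := Finset.le_sup (f := id) hk'
    omega⟩) (hv.add_mul hk _)
  obtain ⟨p, hp, hpw, hpN, hpdec⟩ := exists_prime_dec (h2 k hk) hN (w + 1)
  have : Fact p.Prime := ⟨hp⟩
  have hdec : Dec (K : Set ℕ) (⊤ : SimpleGraph (Fin p)) :=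
    hpdec.mono (Set.singleton_subset_iff.2 (by simpa using hk))
  have hG : Nat.card (Fin n → ZMod p) = p ^ n := by simp
  obtain ⟨μ⟩ : Nonempty (Option (Fin w) ↪ ZMod p) := by
    refine Function.Embedding.nonempty_of_card_le ?_
    simpa using hpw
  have hgdd := HasBIBD.gdd (E := ZMod p) (G := Fin n → ZMod p) (K := K) μ
    (fun i j hij => (sub_ne_zero.2 (fun h => hij (μ.injective h))).isUnit)
    (hn _ (by rw [hG]; exact (Nat.lt_pow_self hp.one_lt).le))
  rw [hG, ← pow_mul] at hgdd
  refine ⟨w * p ^ (n * (w + 1)), ?_, ?_, ?_⟩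
  · refine le_trans (by omega) (Nat.le_mul_of_pos_right w (pow_pos hp.pos _))
  · have := hwmod.mul (hpN.pow (n * (w + 1)))
    simpa using this
  · refine Dec.top_congr (by simp) (Dec.fill hgdd (fun i => ?_))
    refine Dec.top_congr ?_ (hdec.prime_pow hp (n * (w + 1)))
    rw [card_fiber_fst, Nat.card_fin]

/-- The complete graph on `A ⊕ B` with a hole on `B`. -/
def incompleteGraph (A B : Type*) : SimpleGraph (A ⊕ B) where
  Adj x y := x ≠ y ∧ (x.isLeft ∨ y.isLeft)
  symm := ⟨fun _ _ h => ⟨h.1.symm, h.2.symm⟩⟩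
  loopless := ⟨fun _ h => h.1 rfl⟩

/-- Filling in a transversal design with `v` groups of size `p`, leaving one block as a hole. -/
theorem Dec.incompleteGraph {K : Set ℕ} {v p : ℕ} (hp : p.Prime) (hvp : v ≤ p)
    (hv : Dec K (⊤ : SimpleGraph (Fin v))) (hpd : Dec K (⊤ : SimpleGraph (Fin p))) :
    Dec K (incompleteGraph (Fin (v * (p - 1))) (Fin v)) := by
  have : Fact p.Prime := ⟨hp⟩
  let X := Fin v × ZMod p
  have hinj : Function.Injective fun i : Fin v => ((i : ℕ) : ZMod p) := by
    intro i j hij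
    have := congrArg ZMod.val hij
    simp only [ZMod.val_natCast, Nat.mod_eq_of_lt (i.2.trans_le hvp),
      Nat.mod_eq_of_lt (j.2.trans_le hvp)] at this
    exact Fin.ext this
  let G : SimpleGraph X :=
    { Adj := fun x y => x ≠ y ∧ (x.2 ≠ 0 ∨ y.2 ≠ 0)
      symm := ⟨fun _ _ h => ⟨h.1.symm, h.2.symm⟩⟩
      loopless := ⟨fun _ h => h.1 rfl⟩ }
  have hG : Dec K G := by
    refine Dec.of_cliques (ι := Fin v ⊕ {u : ZMod p × ZMod p // u ≠ 0})
      (fun o => match o with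
        | .inl i => {x | x.1 = i}
        | .inr u => {x | x.2 = u.1.1 + u.1.2 * ((x.1 : ℕ) : ZMod p)}) ?_ ?_ ?_ ?_
    · rintro (i | u)
      · refine Dec.top_congr ?_ hpd
        exact (Nat.card_fin p).trans ((Nat.card_zmod p).symm.trans (card_fiber_fst i).symm)
      · refine Dec.top_congr ?_ hv
        refine Nat.card_congr ⟨fun i => ⟨(i, u.1.1 + u.1.2 * ((i : ℕ) : ZMod p)), rfl⟩,
          fun x => x.1.1, fun _ => rfl, ?_⟩
        rintro ⟨⟨i, a⟩, h⟩
        exact Subtype.ext (Prod.ext rfl h.symm)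
    · rintro (i | u) x hx y hy hxy
      · refine ⟨hxy, ?_⟩
        by_contra! h
        exact hxy (Prod.ext (Eq.trans hx (Eq.symm hy)) (h.1.trans h.2.symm))
      · refine ⟨hxy, ?_⟩
        by_contra! h
        obtain ⟨⟨a, b⟩, hu⟩ := u
        have hx' : x.2 = a + b * ((x.1 : ℕ) : ZMod p) := hx
        have hy' : y.2 = a + b * ((y.1 : ℕ) : ZMod p) := hy
        have hne : ((x.1 : ℕ) : ZMod p) - ((y.1 : ℕ) : ZMod p) ≠ 0 := by
          intro h'
          exact hxy (Prod.ext (hinj (sub_eq_zero.1 h')) (h.1.trans h.2.symm))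
        have hb : b = 0 := by
          refine (mul_eq_zero.1 (?_ : b * _ = 0)).resolve_right hne
          linear_combination hy' - hx' + h.1 - h.2
        subst hb
        refine hu (Prod.ext ?_ rfl)
        change a = 0
        linear_combination h.1 - hx'
    · rintro x y ⟨hxy, h⟩
      by_cases h1 : x.1 = y.1
      · exact ⟨.inl x.1, rfl, h1.symm⟩
      · have hne : ((x.1 : ℕ) : ZMod p) - ((y.1 : ℕ) : ZMod p) ≠ 0 := by
          intro h'
          exact h1 (hinj (sub_eq_zero.1 h'))
        set b := (x.2 - y.2) / (((x.1 : ℕ) : ZMod p) - ((y.1 : ℕ) : ZMod p)) with hb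
        have hb' : b * (((x.1 : ℕ) : ZMod p) - ((y.1 : ℕ) : ZMod p)) = x.2 - y.2 :=
          div_mul_cancel₀ _ hne
        refine ⟨.inr ⟨(x.2 - b * ((x.1 : ℕ) : ZMod p), b), ?_⟩, ?_, ?_⟩
        · intro h0
          rw [Prod.mk_eq_zero] at h0
          rw [h0.2] at hb'
          rw [h0.2, zero_mul, sub_zero] at h0
          rcases h with h | h
          · exact h h0.1
          · refine h ?_
            linear_combination hb' + h0.1
        · change x.2 = _ + _
          ring
        · change y.2 = _ + _
          dsimp only
          linear_combination hb'
    · rintro x y ⟨hxy, h⟩ (i | ⟨⟨a, b⟩, hu⟩) (j | ⟨⟨a', b'⟩, hu'⟩) hx hy hx' hy'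
      · rw [show i = j from Eq.trans (Eq.symm hx) hx']
      · have h1 : x.1 = y.1 := Eq.trans hx (Eq.symm hy)
        have h2 : x.2 = a' + b' * ((x.1 : ℕ) : ZMod p) := hx'
        have h3 : y.2 = a' + b' * ((y.1 : ℕ) : ZMod p) := hy'
        rw [h1, ← h3] at h2
        exact (hxy (Prod.ext h1 h2)).elim
      · have h1 : x.1 = y.1 := Eq.trans hx' (Eq.symm hy')
        have h2 : x.2 = a + b * ((x.1 : ℕ) : ZMod p) := hx
        have h3 : y.2 = a + b * ((y.1 : ℕ) : ZMod p) := hy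
        rw [h1, ← h3] at h2
        exact (hxy (Prod.ext h1 h2)).elim
      · have e1 : x.2 = a + b * ((x.1 : ℕ) : ZMod p) := hx
        have e2 : y.2 = a + b * ((y.1 : ℕ) : ZMod p) := hy
        have e3 : x.2 = a' + b' * ((x.1 : ℕ) : ZMod p) := hx'
        have e4 : y.2 = a' + b' * ((y.1 : ℕ) : ZMod p) := hy'
        have hne : ((x.1 : ℕ) : ZMod p) - ((y.1 : ℕ) : ZMod p) ≠ 0 := by
          intro h'
          have h1 := hinj (sub_eq_zero.1 h')
          rw [h1, ← e2] at e1
          exact hxy (Prod.ext h1 e1)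
        obtain rfl : b = b' := by
          refine mul_right_cancel₀ hne ?_
          linear_combination e3 - e4 - e1 + e2
        obtain rfl : a = a' := by
          linear_combination e3 - e1
        rfl
  have hz : Nat.card {x : X // x.2 = 0} = v := by
    rw [Nat.card_congr (⟨fun x => x.1.1, fun i => ⟨(i, 0), rfl⟩, ?_, fun _ => rfl⟩ :
      {x : X // x.2 = 0} ≃ Fin v), Nat.card_fin]
    rintro ⟨⟨i, a⟩, h⟩
    exact Subtype.ext (Prod.ext rfl (Eq.symm h))
  have hnz : Nat.card {x : X // x.2 ≠ 0} = v * (p - 1) := by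
    have h1 := Nat.card_congr (Equiv.sumCompl fun x : X => x.2 = 0)
    rw [Nat.card_sum, hz, Nat.card_prod, Nat.card_fin, Nat.card_zmod] at h1
    rw [Nat.mul_sub, mul_one, ← h1, Nat.add_sub_cancel_left]
  let e₁ : {x : X // x.2 ≠ 0} ≃ Fin (v * (p - 1)) := (Finite.card_eq.1 (by simpa using hnz)).some
  let e₂ : {x : X // x.2 = 0} ≃ Fin v := (Finite.card_eq.1 (by simpa using hz)).some
  let e : X ≃ Fin (v * (p - 1)) ⊕ Fin v := (Equiv.sumCompl fun x : X => x.2 = 0).symm.trans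
    ((Equiv.sumComm _ _).trans (Equiv.sumCongr e₁ e₂))
  have he : ∀ x, (e x).isLeft = true ↔ x.2 ≠ 0 := by
    intro x
    by_cases hx : x.2 = 0
    · simp [e, Equiv.sumCompl_symm_apply_of_pos, hx]
    · simp [e, Equiv.sumCompl_symm_apply_of_neg, hx]
  refine hG.iso e (fun x y => ?_)
  change e x ≠ e y ∧ _ ↔ x ≠ y ∧ _
  rw [he, he, e.injective.ne_iff]

/-- The partition of `(A × B) ⊕ C` into copies of `B`, indexed by `A`, and one copy of `C`. -/
def groupOf {A B C : Type*} : (A × B) ⊕ C → Option A := Sum.elim (fun x => some x.1) (fun _ => none)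

theorem card_groupOf_eq_none {A B C : Type*} :
    Nat.card {x : (A × B) ⊕ C // groupOf x = none} = Nat.card C := by
  refine Nat.card_congr (Equiv.symm (Equiv.ofBijective (fun c => ⟨.inr c, rfl⟩) ⟨?_, ?_⟩))
  · intro c c' h
    exact Sum.inr_injective (congrArg Subtype.val h)
  · rintro ⟨x | c, h⟩
    · cases h
    · exact ⟨c, rfl⟩

theorem card_groupOf_eq_some {A B C : Type*} (a : A) :
    Nat.card {x : (A × B) ⊕ C // groupOf x = some a} = Nat.card B := by
  refine Nat.card_congr (Equiv.symm (Equiv.ofBijective (fun b => ⟨.inl (a, b), rfl⟩) ⟨?_, ?_⟩))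
  · intro b b' h
    exact congrArg Prod.snd (Sum.inl_injective (congrArg Subtype.val h))
  · rintro ⟨⟨a', b⟩ | c, h⟩
    · obtain rfl : a' = a := Option.some_injective _ h
      exact ⟨b, rfl⟩
    · cases h

/-- A truncated transversal design with one special group of arbitrary size, inflated. -/
theorem dec_groupOf_sigma {K : Set ℕ} {u M T z y c : ℕ} (hM : ∀ l, u ≤ l → GDD K M l)
    (hN : ∀ l, u ≤ l → GDD K (M * T) l) (hT : HasUD c (T * z)) (hy : y ≤ T * z)
    {J : Type} [Finite J] (h : J → ℕ) (hJ : Nat.card J < c) (hu : ∀ j, u ≤ h j)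
    (hz : ∀ j, h j ≤ z) (hcard : u ≤ {j | h j = z}.ncard) :
    Dec K (multipartite (groupOf : ((Σ j, Fin (h j)) × Fin (M * T)) ⊕ Fin (M * y) → _)) := by
  let g : Option J → ℕ := fun o => o.elim y (fun j => T * h j)
  have h1 : Dec {n | u ≤ n} (multipartite (Sigma.fst : (Σ i, Fin (g i)) → Option J)) := by
    refine hT.dec_sigma ?_ g ?_ ?_
    · rw [Finite.card_option]
      exact hJ
    · rintro (_ | j)
      · exact hy
      · exact Nat.mul_le_mul_left T (hz j)
    · intro S hS
      right
      refine hcard.trans ?_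
      rw [← Set.ncard_image_of_injective _ (Option.some_injective J)]
      refine Set.ncard_le_ncard ?_ (Set.toFinite _)
      rintro _ ⟨j, hj, rfl⟩
      refine hS ?_
      change T * h j = T * z
      rw [show h j = z from hj]
  have h2 := Dec.inflate (g := M) (fun l hl => hM l hl) h1
  rw [SimpleGraph.comap_comap] at h2
  refine Dec.multipartite_fill (Option.map Sigma.fst) ?_ ?_
  · refine Dec.multipartite_congr (Equiv.refl _) ?_ h2
    have e : ∀ i, {x : (Σ i, Fin (g i)) × Fin M // (Sigma.fst ∘ Prod.fst) x = i} ≃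
        Fin (g i) × Fin M := by
      intro i
      refine Equiv.symm (Equiv.ofBijective (fun x => ⟨(⟨i, x.1⟩, x.2), rfl⟩) ⟨?_, ?_⟩)
      · rintro ⟨a, b⟩ ⟨a', b'⟩ h
        simpa using congrArg Subtype.val h
      · rintro ⟨⟨⟨i, a⟩, b⟩, rfl⟩
        exact ⟨(a, b), rfl⟩
    rintro (_ | j)
    · rw [Nat.card_congr (e none)]
      have : ∀ x : ((Σ j, Fin (h j)) × Fin (M * T)) ⊕ Fin (M * y),
          (Option.map Sigma.fst ∘ groupOf) x = Equiv.refl (Option J) none ↔ groupOf x = none := by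
        intro x
        simp
      rw [Nat.card_congr (Equiv.subtypeEquivRight this), card_groupOf_eq_none]
      simp [g, mul_comm]
    · rw [Nat.card_congr (e (some j))]
      have e' : Fin (h j) × Fin (M * T) ≃ {x : ((Σ j, Fin (h j)) × Fin (M * T)) ⊕ Fin (M * y) //
          (Option.map Sigma.fst ∘ groupOf) x = Equiv.refl (Option J) (some j)} := by
        refine Equiv.ofBijective (fun x => ⟨.inl (⟨j, x.1⟩, x.2), rfl⟩) ⟨?_, ?_⟩
        · rintro ⟨a, b⟩ ⟨a', b'⟩ h
          simpa using congrArg Subtype.val h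
        · rintro ⟨⟨⟨j', a⟩, b⟩ | c, h⟩
          · obtain rfl : j' = j := Option.some_injective _ h
            exact ⟨(a, b), rfl⟩
          · cases h
      rw [← Nat.card_congr e']
      simp only [Nat.card_prod, Nat.card_fin, g, Option.elim]
      ring
  · rintro (_ | j)
    · refine Dec.of_no_adj ?_
      rintro ⟨x | x, hx⟩ ⟨y | y, hy⟩ hxy
      · cases hx
      · cases hx
      · cases hy
      · exact (multipartite_adj _ _ _).1 hxy rfl
    · let φ : Fin (h j) × Fin (M * T) →
          {x : ((Σ j, Fin (h j)) × Fin (M * T)) ⊕ Fin (M * y) //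
            Option.map Sigma.fst (groupOf x) = some j} :=
        fun x => ⟨.inl (⟨j, x.1⟩, x.2), rfl⟩
      have hφ : Function.Bijective φ := by
        refine ⟨?_, ?_⟩
        · rintro ⟨a, b⟩ ⟨a', b'⟩ h
          simpa [φ] using congrArg Subtype.val h
        · rintro ⟨⟨⟨j', a⟩, b⟩ | c, h⟩
          · obtain rfl : j' = j := Option.some_injective _ h
            exact ⟨(a, b), rfl⟩
          · cases h
      refine Dec.iso (hN _ (hu j)) (Equiv.ofBijective φ hφ) (fun x x' => ?_)
      rw [multipartite_adj, multipartite_adj]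
      change some (⟨j, x.1⟩ : Σ j, Fin (h j)) ≠ some ⟨j, x'.1⟩ ↔ x.1 ≠ x'.1
      simp

theorem dec_groupOf {K : Set ℕ} {u M T z y c : ℕ} (hM : ∀ l, u ≤ l → GDD K M l)
    (hN : ∀ l, u ≤ l → GDD K (M * T) l) (hT : HasUD c (T * z)) (hy : y ≤ T * z) (hz : 2 * u + 1 ≤ z)
    {W : ℕ} (hW : (u + 1) * z ≤ W) (hWc : W / z + 1 < c) :
    Dec K (multipartite (groupOf : (Fin W × Fin (M * T)) ⊕ Fin (M * y) → _)) := by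
  have hz0 : 0 < z := by omega
  have hl : u + 1 ≤ W / z := (Nat.le_div_iff_mul_le hz0).2 hW
  have hr : W % z < z := Nat.mod_lt _ hz0
  have hdm := Nat.div_add_mod W z
  set l := W / z - 1 with hl'
  set r := W % z + z with hr'
  let h : Option (Option (Fin l)) → ℕ := fun o => o.elim (r / 2)
    (fun o => o.elim (r - r / 2) (fun _ => z))
  have hsum : Nat.card (Σ j, Fin (h j)) = W := by
    rw [Nat.card_sigma, Fintype.sum_option, Fintype.sum_option]
    simp only [h, Option.elim, Nat.card_fin, Finset.sum_const, Finset.card_univ, Fintype.card_fin,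
      smul_eq_mul]
    have h1 : W / z = l + 1 := by omega
    rw [h1] at hdm
    have h2 : z * (l + 1) = l * z + z := by ring
    omega
  have key := dec_groupOf_sigma hM hN hT hy h ?_ ?_ ?_ ?_
  · refine Dec.multipartite_congr
      (Equiv.optionCongr (Finite.card_eq.1 (by rw [hsum, Nat.card_fin])).some) ?_ key
    rintro (_ | j)
    · rw [card_groupOf_eq_none]
      exact card_groupOf_eq_none.symm
    · rw [card_groupOf_eq_some]
      exact (card_groupOf_eq_some _).symm
  · rw [Finite.card_option, Finite.card_option, Nat.card_fin]
    omega
  · rintro (_ | _ | j)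
    · change u ≤ r / 2
      omega
    · change u ≤ r - r / 2
      omega
    · change u ≤ z
      omega
  · rintro (_ | _ | j)
    · change r / 2 ≤ z
      omega
    · change r - r / 2 ≤ z
      omega
    · exact le_rfl
  · have hinj : Function.Injective fun j : Fin l => some (some j) :=
      (Option.some_injective _).comp (Option.some_injective _)
    have h1 : Set.range (fun j : Fin l => some (some j)) ⊆ {j | h j = z} := by
      rintro _ ⟨j, rfl⟩
      rfl
    refine le_trans ?_ (Set.ncard_le_ncard h1 (Set.toFinite _))
    rw [Set.ncard_range_of_injective hinj, Nat.card_fin]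
    omega

/-- The points in the columns indexed by `A`, together with all the points outside of columns. -/
def cylinder {V R C : Type*} {F : V → Type*} (A : Set V) : Set (((Σ v, F v) × R) ⊕ C) :=
  {x | Sum.elim (fun a => a.1.1 ∈ A) (fun _ => True) x}

theorem exists_isDec_cylinder {K : Set ℕ} {u N s t : ℕ} {V : Type} {w : V → ℕ}
    {𝓑 : Set (Finset (Σ v, Fin (w v)))}
    (hB : IsDec {l | u ≤ l} (multipartite Sigma.fst) 𝓑)
    (hN : ∀ l, u ≤ l → GDD K N l)
    (hw : ∀ v, Dec K (multipartite (groupOf : (Fin (w v) × Fin N) ⊕ Fin s → _)))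
    (ht : Dec K (incompleteGraph (Fin N) (Fin t)))
    (hs : Dec K (⊤ : SimpleGraph (Fin s ⊕ Fin t))) :
    ∃ 𝓓, IsDec K (⊤ : SimpleGraph (((Σ v, Fin (w v)) × Fin N) ⊕ (Fin s ⊕ Fin t))) 𝓓 ∧
      ∀ A : Set V, (∀ B ∈ 𝓑, ∀ x ∈ B, ∀ y ∈ B, x ≠ y → x.1 ∈ A → y.1 ∈ A → ∀ z ∈ B, z.1 ∈ A) →
        ∀ B ∈ 𝓓, ∀ x ∈ B, ∀ y ∈ B, x ≠ y → x ∈ cylinder A → y ∈ cylinder A →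
          ∀ z ∈ B, z ∈ cylinder A := by
  classical
  let X := ((Σ v, Fin (w v)) × Fin N) ⊕ (Fin s ⊕ Fin t)
  let ι := 𝓑 ⊕ V ⊕ (Σ v, Fin (w v)) ⊕ Unit
  let Z : ι → Type := fun i => match i with
    | .inl B => B.1 × Fin N
    | .inr (.inl v) => (Fin (w v) × Fin N) ⊕ Fin s
    | .inr (.inr (.inl _)) => Fin N ⊕ Fin t
    | .inr (.inr (.inr _)) => Fin s ⊕ Fin t
  let H : ∀ i, SimpleGraph (Z i) := fun i => match i with
    | .inl B => multipartite (Prod.fst : B.1 × Fin N → B.1)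
    | .inr (.inl v) => multipartite (groupOf : (Fin (w v) × Fin N) ⊕ Fin s → Option (Fin (w v)))
    | .inr (.inr (.inl _)) => incompleteGraph (Fin N) (Fin t)
    | .inr (.inr (.inr _)) => (⊤ : SimpleGraph (Fin s ⊕ Fin t))
  let φ : ∀ i, Z i → X := fun i => match i with
    | .inl B => fun z : B.1 × Fin N => .inl (z.1.1, z.2)
    | .inr (.inl v) => Sum.elim (fun z : Fin (w v) × Fin N => .inl (⟨v, z.1⟩, z.2))
        (fun z => .inr (.inl z))
    | .inr (.inr (.inl x)) => Sum.elim (fun z : Fin N => .inl (x, z)) (fun z => .inr (.inr z))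
    | .inr (.inr (.inr _)) => Sum.inr
  have hH : ∀ i, Dec K (H i) := by
    rintro (B | v | x | _)
    · refine (hN _ (hB.1 B.1 B.2).1).dec (by simp) (fun i => ?_)
      rw [card_fiber_fst, Nat.card_fin]
    exacts [hw v, ht, hs]
  have hφ : ∀ i, Function.Injective (φ i) := by
    rintro (B | v | x | _)
    · rintro ⟨⟨a, ha⟩, b⟩ ⟨⟨a', ha'⟩, b'⟩ h
      have := Sum.inl_injective h
      simp only [Prod.mk.injEq] at this
      obtain ⟨rfl, rfl⟩ := this
      rfl
    · rintro (⟨a, b⟩ | a) (⟨a', b'⟩ | a') h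
      · have := Sum.inl_injective h
        simp only [Prod.mk.injEq, Sigma.mk.injEq, heq_eq_eq, true_and] at this
        obtain ⟨rfl, rfl⟩ := this
        rfl
      · cases h
      · cases h
      · rw [Sum.inl_injective (Sum.inr_injective h)]
    · rintro (a | a) (a' | a') h
      · have := congrArg Prod.snd (Sum.inl_injective h)
        rw [show a = a' from this]
      · cases h
      · cases h
      · rw [Sum.inr_injective (Sum.inr_injective h)]
    · exact Sum.inr_injective
  have hu : ∀ a b : Σ v, Fin (w v), a.1 ≠ b.1 → ∃! B, B ∈ 𝓑 ∧ a ∈ B ∧ b ∈ B :=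
    fun a b h => hB.2 a b ((multipartite_adj _ _ _).2 h)
  let code : X → X → ι := fun x y => match x, y with
    | .inl a, .inl b => if h : a.1.1 = b.1.1 then
        (if a.1 = b.1 then .inr (.inr (.inl a.1)) else .inr (.inl a.1.1))
        else .inl ⟨(hu a.1 b.1 h).choose, (hu a.1 b.1 h).choose_spec.1.1⟩
    | .inl a, .inr (.inl _) => .inr (.inl a.1.1)
    | .inl a, .inr (.inr _) => .inr (.inr (.inl a.1))
    | .inr (.inl _), .inl a => .inr (.inl a.1.1)
    | .inr (.inr _), .inl a => .inr (.inr (.inl a.1))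
    | .inr _, .inr _ => .inr (.inr (.inr ()))
  have hblock : ∀ B ∈ 𝓑, ∀ x ∈ B, ∀ y ∈ B, x ≠ y → x.1 ≠ y.1 := fun B hBB x hx y hy hxy =>
    (multipartite_adj _ _ _).1 ((hB.1 B hBB).2 x hx y hy hxy)
  have hcode : ∀ i z z', (H i).Adj z z' → code (φ i z) (φ i z') = i := by
    rintro (B | v | x | _)
    · rintro ⟨⟨a, ha⟩, b⟩ ⟨⟨a', ha'⟩, b'⟩ h
      have h1 : a ≠ a' := fun h' => (multipartite_adj _ _ _).1 h (Subtype.ext h')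
      have h2 := hblock B.1 B.2 a ha a' ha' h1
      change dite _ _ _ = _
      rw [dif_neg h2]
      exact congrArg Sum.inl (Subtype.ext
        (((hu a a' h2).choose_spec.2 B.1 ⟨B.2, ha, ha'⟩).symm))
    · rintro (⟨a, b⟩ | a) (⟨a', b'⟩ | a') h
      · have h1 : some a ≠ some a' := (multipartite_adj _ _ _).1 h
        change dite _ _ _ = _
        rw [dif_pos rfl, if_neg]
        intro h2
        exact h1 (by simpa using h2)
      · rfl
      · rfl
      · exact ((multipartite_adj _ _ _).1 h rfl).elim
    · rintro (a | a) (a' | a') h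
      · change dite _ _ _ = _
        rw [dif_pos rfl, if_pos rfl]
      · rfl
      · rfl
      · rcases h.2 with h | h <;> cases h
    · rintro (z | z) (z' | z') h <;> rfl
  choose 𝓒 h𝓒 using hH
  refine ⟨_, IsDec.glue h𝓒 (fun i => ⟨φ i, hφ i⟩) ?_ ?_ ?_, ?_⟩
  · intro i z z' h h'
    exact h.ne (hφ i h')
  · rintro (⟨a, n⟩ | x | x) (⟨b, m⟩ | y | y) hxy
    · by_cases h : a.1 = b.1
      · by_cases hab : a = b
        · subst hab
          refine ⟨.inr (.inr (.inl a)), .inl n, .inl m, ⟨?_, Or.inl rfl⟩, rfl, rfl⟩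
          intro h'
          exact hxy (by rw [Sum.inl_injective h'])
        · obtain ⟨v, a⟩ := a
          obtain ⟨v', b⟩ := b
          obtain rfl : v = v' := h
          refine ⟨.inr (.inl v), .inl (a, n), .inl (b, m), (multipartite_adj _ _ _).2 ?_, rfl, rfl⟩
          intro h'
          exact hab (by rw [show a = b from Option.some_injective _ h'])
      · obtain ⟨B, ⟨hBB, ha, hb⟩, -⟩ := hu a b h
        refine ⟨.inl ⟨B, hBB⟩, (⟨a, ha⟩, n), (⟨b, hb⟩, m), (multipartite_adj _ _ _).2 ?_, rfl, rfl⟩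
        intro h'
        exact h (congrArg (fun x => x.1.1) h')
    · exact ⟨.inr (.inl a.1), .inl (a.2, n), .inr y,
        (multipartite_adj _ _ _).2 (Option.some_ne_none _), rfl, rfl⟩
    · exact ⟨.inr (.inr (.inl a)), .inl n, .inr y, ⟨Sum.inl_ne_inr, Or.inl rfl⟩, rfl, rfl⟩
    · exact ⟨.inr (.inl b.1), .inr x, .inl (b.2, m),
        (multipartite_adj _ _ _).2 (Option.some_ne_none _).symm, rfl, rfl⟩
    · exact ⟨.inr (.inr (.inr ())), .inl x, .inl y, fun h => hxy (by rw [h]), rfl, rfl⟩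
    · exact ⟨.inr (.inr (.inr ())), .inl x, .inr y, fun h => hxy (by rw [h]), rfl, rfl⟩
    · exact ⟨.inr (.inr (.inl b)), .inr x, .inl m, ⟨Sum.inr_ne_inl, Or.inr rfl⟩, rfl, rfl⟩
    · exact ⟨.inr (.inr (.inr ())), .inr x, .inl y, fun h => hxy (by rw [h]), rfl, rfl⟩
    · exact ⟨.inr (.inr (.inr ())), .inr x, .inr y, fun h => hxy (by rw [h]), rfl, rfl⟩
  · intro i j z z' z₁ z₁' h h' e e'
    rw [← hcode i z z' h, ← hcode j z₁ z₁' h']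
    exact congrArg₂ code e e'
  · rintro A hA _ ⟨i, C, hC, rfl⟩ x hx y hy hxy hxA hyA z hz
    rw [Finset.mem_map] at hx hy hz
    obtain ⟨x, hx, rfl⟩ := hx
    obtain ⟨y, hy, rfl⟩ := hy
    obtain ⟨z, hz, rfl⟩ := hz
    have hadj := ((h𝓒 i).1 C hC).2 x hx y hy (fun h => hxy (by rw [h]))
    clear hx hy hz hC hxy C
    revert x y z
    rcases i with B | v | a | _
    · intro x hxA y hyA z hadj
      refine hA B.1 B.2 _ x.1.2 _ y.1.2 ?_ hxA hyA _ z.1.2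
      exact fun h => (multipartite_adj _ _ _).1 hadj (Subtype.ext h)
    · intro x hxA y hyA z hadj
      have hv : v ∈ A := by
        rcases x with x | x
        · exact hxA
        · rcases y with y | y
          · exact hyA
          · exact ((multipartite_adj _ _ _).1 hadj rfl).elim
      rcases z with z | z
      exacts [hv, trivial]
    · intro x hxA y hyA z hadj
      have hv : a.1 ∈ A := by
        rcases x with x | x
        · exact hxA
        · rcases y with y | y
          · exact hyA
          · rcases hadj.2 with h | h <;> cases h
      rcases z with z | z
      exacts [hv, trivial]
    · intro x hxA y hyA z hadj
      exact trivial

theorem exists_affClosed {P n d : ℕ} [Fact P.Prime] (hd : 0 < d) (x : Fin d → Fin n → ZMod P) :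
    ∃ A : Set (Fin n → ZMod P), AffClosed A ∧ (∀ i, x i ∈ A) ∧ A.ncard ≤ P ^ d := by
  let x₀ := x ⟨0, hd⟩
  refine ⟨Set.range fun t : Fin d → ZMod P => x₀ + ∑ i, t i • (x i - x₀), ?_, ?_, ?_⟩
  · rintro _ ⟨t, rfl⟩ _ ⟨t', rfl⟩ c
    refine ⟨t + c • (t' - t), ?_⟩
    simp only [Pi.add_apply, Pi.smul_apply, Pi.sub_apply, smul_eq_mul, add_smul, mul_smul,
      Finset.sum_add_distrib, sub_smul, Finset.sum_sub_distrib, ← Finset.smul_sum]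
    module
  · intro i
    refine ⟨Pi.single i 1, ?_⟩
    simp [Pi.single_apply]
  · rw [← Set.image_univ]
    refine (Set.ncard_image_le (Set.toFinite _)).trans ?_
    rw [Set.ncard_univ]
    simp

theorem card_cylinder_le {V : Type*} [Finite V] {w : V → ℕ} {W : ℕ} (hw : ∀ v, w v ≤ W)
    {R C : Type*} [Finite R] [Finite C] (A : Set V) :
    (cylinder A : Set (((Σ v, Fin (w v)) × R) ⊕ C)).ncard ≤
      A.ncard * W * Nat.card R + Nat.card C := by
  have h1 : Nat.card (((A × Fin W) × R) ⊕ C) = A.ncard * W * Nat.card R + Nat.card C := by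
    rw [Nat.card_sum, Nat.card_prod, Nat.card_prod, Nat.card_fin, Nat.card_coe_set_eq]
  rw [← h1, ← Nat.card_coe_set_eq]
  let Y : Set (((Σ v, Fin (w v)) × R) ⊕ C) := cylinder A
  let f : Y → ((A × Fin W) × R) ⊕ C := fun x => match x with
    | ⟨.inl a, h⟩ => .inl ((⟨a.1.1, h⟩, Fin.castLE (hw _) a.1.2), a.2)
    | ⟨.inr c, _⟩ => .inr c
  refine Nat.card_le_card_of_injective (α := Y) f ?_
  rintro ⟨⟨⟨v, a⟩, r⟩ | c, h⟩ ⟨⟨⟨v', a'⟩, r'⟩ | c', h'⟩ hf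
  · have h2 := Sum.inl_injective hf
    simp only [Prod.mk.injEq] at h2
    obtain ⟨⟨h3, h4⟩, rfl⟩ := h2
    obtain rfl : v = v' := congrArg Subtype.val h3
    obtain rfl := Fin.castLE_injective _ h4
    rfl
  · cases hf
  · cases hf
  · obtain rfl := Sum.inr_injective hf
    rfl

/-- There is a pairwise balanced design on `v` points in which any `d` points lie in a flat of
size at most `f`. -/
def HasSmallFlats (K : Set ℕ) (d f v : ℕ) : Prop :=
  ∃ Blocks : Finset (Finset (Fin v)), IsPBD Finset.univ K Blocks ∧
    ∀ S : Finset (Fin v), S.card = d →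
      ∃ Y : Finset (Fin v), IsFlat Finset.univ Blocks Y ∧ S ⊆ Y ∧ Y.card ≤ f

theorem HasSmallFlats.mono {K L : Set ℕ} {d f g v : ℕ} (hKL : K ⊆ L) (hfg : f ≤ g)
    (h : HasSmallFlats K d f v) : HasSmallFlats L d g v := by
  obtain ⟨𝓑, h1, h2⟩ := h
  refine ⟨𝓑, ⟨fun B hB => ⟨(h1.1 B hB).1, hKL (h1.1 B hB).2⟩, h1.2⟩, fun S hS => ?_⟩
  obtain ⟨Y, hY, hSY, hYf⟩ := h2 S hS
  exact ⟨Y, hY, hSY, hYf.trans hfg⟩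

theorem IsDec.hasSmallFlats {K : Set ℕ} {X : Type*} [Finite X] {𝓑 : Set (Finset X)}
    (h : IsDec K (⊤ : SimpleGraph X) 𝓑) {d f v : ℕ} (hX : Nat.card X = v)
    (hf : ∀ x : Fin d → X, ∃ Y : Set X, (∀ i, x i ∈ Y) ∧ Y.ncard ≤ f ∧
      ∀ B ∈ 𝓑, ∀ x ∈ B, ∀ y ∈ B, x ≠ y → x ∈ Y → y ∈ Y → ∀ z ∈ B, z ∈ Y) :
    HasSmallFlats K d f v := by
  classical
  have := Fintype.ofFinite X
  let e : X ≃ Fin v := (Finite.card_eq.1 (by rw [hX, Nat.card_fin])).some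
  let 𝓓 : Finset (Finset (Fin v)) :=
    Finset.univ.filter fun D => D.map e.symm.toEmbedding ∈ 𝓑
  have h𝓓 : ∀ D, D ∈ 𝓓 ↔ D.map e.symm.toEmbedding ∈ 𝓑 := by simp [𝓓]
  have hmem : ∀ (D : Finset (Fin v)) x, x ∈ D ↔ e.symm x ∈ D.map e.symm.toEmbedding := by simp
  have hex : ∀ x y : Fin v, x ≠ y → ∃ B ∈ 𝓑, e.symm x ∈ B ∧ e.symm y ∈ B ∧
      B.map e.toEmbedding ∈ 𝓓 := by
    intro x y hxy
    obtain ⟨B, ⟨hB, hx, hy⟩, -⟩ := h.2 (e.symm x) (e.symm y) (by simpa using hxy)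
    refine ⟨B, hB, hx, hy, ?_⟩
    rw [h𝓓, Finset.map_map]
    convert hB
    ext
    simp
  refine ⟨𝓓, ⟨fun D hD => ⟨Finset.subset_univ _, ?_⟩, fun x _ y _ hxy => ?_⟩, fun S hS => ?_⟩
  · simpa using (h.1 _ ((h𝓓 D).1 hD)).1
  · obtain ⟨B, hB, hx, hy, hBD⟩ := hex x y hxy
    refine ⟨B.map e.toEmbedding, ⟨hBD, by simpa using hx, by simpa using hy⟩, ?_⟩
    rintro D ⟨hD, hxD, hyD⟩
    have := (h.2 (e.symm x) (e.symm y) (by simpa using hxy)).unique ⟨hB, hx, hy⟩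
      ⟨(h𝓓 D).1 hD, (hmem D x).1 hxD, (hmem D y).1 hyD⟩
    subst this
    ext
    simp
  · let g : Fin d ≃ S := (Finite.card_eq.1 (by simp [hS])).some
    obtain ⟨Y, hxY, hYf, hY⟩ := hf fun i => e.symm (g i)
    refine ⟨Finset.univ.filter fun x => e.symm x ∈ Y, ⟨Finset.subset_univ _, ?_⟩, ?_, ?_⟩
    · intro x hx y hy hxy
      obtain ⟨B, hB, hxB, hyB, hBD⟩ := hex x y hxy
      refine ⟨_, hBD, by simpa using hxB, by simpa using hyB, ?_⟩
      intro z hz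
      refine Finset.mem_filter.2 ⟨Finset.mem_univ _, ?_⟩
      exact hY B hB _ hxB _ hyB (by simpa using hxy) (Finset.mem_filter.1 hx).2
        (Finset.mem_filter.1 hy).2 _ (by simpa using hz)
    · intro x hx
      have := hxY (g.symm ⟨x, hx⟩)
      simpa using this
    · refine le_trans ?_ hYf
      rw [← Set.ncard_coe_finset]
      refine Set.ncard_le_ncard_of_injOn e.symm ?_ e.symm.injective.injOn (Set.toFinite _)
      intro x hx
      exact (Finset.mem_filter.1 hx).2

theorem hasSmallFlats_of_dec {K : Set ℕ} {d u P N s t W₀ : ℕ} (hd : 0 < d) (hu : 1 ≤ u)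
    (hW₀ : 1 ≤ W₀) (hP : P.Prime)
    (hrow : ∀ W, W₀ ≤ W → Dec (Set.Icc (2 * u) P) (⊤ : SimpleGraph (Fin W)))
    (hN : ∀ l, u ≤ l → GDD K N l)
    (hW : ∀ W, W₀ ≤ W → W ≤ W₀ * P →
      Dec K (multipartite (groupOf : (Fin W × Fin N) ⊕ Fin s → _)))
    (ht : Dec K (incompleteGraph (Fin N) (Fin t)))
    (hs : Dec K (⊤ : SimpleGraph (Fin s ⊕ Fin t))) {U : ℕ} (hU : W₀ ≤ U) :
    HasSmallFlats K d (P ^ d * (W₀ * P) * N + (s + t)) (U * N + (s + t)) := by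
  have : Fact P.Prime := ⟨hP⟩
  obtain ⟨n, W, r, hW1, hW2, hr, rfl⟩ := exists_mul_pow_add hP.two_le hW₀ hU
  have hV : Nat.card (Fin n → ZMod P) = P ^ n := by simp
  obtain ⟨w, hw, hcard⟩ := exists_balanced (V := Fin n → ZMod P) W r (by rw [hV]; exact hr.le)
  obtain ⟨𝓑, h𝓑, hA⟩ := exists_isDec_over_affine (P := P) hu
    (fun W' h _ => hrow W' (hW1.trans h)) w hw
  have hwW : ∀ v, W₀ ≤ w v ∧ w v ≤ W₀ * P := by
    intro v
    rcases hw v with h | h <;> rw [h] <;> constructor <;> omega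
  obtain ⟨𝓓, h𝓓, hflat⟩ := exists_isDec_cylinder (u := u)
    ⟨fun B hB => ⟨(h𝓑.1 B hB).1.1, (h𝓑.1 B hB).2⟩, h𝓑.2⟩ hN
    (fun v => hW _ (hwW v).1 (hwW v).2) ht hs
  refine h𝓓.hasSmallFlats ?_ (fun x => ?_)
  · rw [Nat.card_sum, Nat.card_prod, hcard, hV]
    simp
  · obtain ⟨A, hAff, hxA, hAc⟩ := exists_affClosed (P := P) hd
      (fun i => Sum.elim (fun a => a.1.1) (fun _ => 0) (x i))
    refine ⟨cylinder A, fun i => ?_, ?_, fun B hB => hflat A (hA A hAff) B hB⟩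
    · have := hxA i
      revert this
      generalize x i = y
      rcases y with y | y
      exacts [fun h => h, fun _ => trivial]
    · refine (card_cylinder_le (fun v => (hwW v).2) A).trans ?_
      rw [Nat.card_sum, Nat.card_fin, Nat.card_fin, Nat.card_fin]
      gcongr

theorem HasUD.of_factorial_pow_dvd {c n : ℕ} (hn : n ≠ 0) (h : c.factorial ^ c ∣ n) :
    HasUD c n := by
  refine HasUD.of_factorization hn (fun p hp hpn => ?_)
  rcases le_or_gt p c with hpc | hpc
  · have h1 : p ^ c ∣ n := (pow_dvd_pow_of_dvd (Nat.dvd_factorial hp.pos hpc) c).trans h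
    have h2 := (hp.pow_dvd_iff_le_factorization hn).1 h1
    exact (Nat.lt_pow_self hp.one_lt).le.trans (Nat.pow_le_pow_right hp.pos h2)
  · have h2 := (hp.dvd_iff_one_le_factorization hn).1 hpn
    exact hpc.le.trans (by simpa using Nat.pow_le_pow_right hp.pos h2)

/-- Bounds for every residue class give uniform bounds. -/
theorem exists_uniform_of_modEq {Q : ℕ → Prop} {R : ℕ → ℕ → Prop}
    (hR : ∀ f g v, f ≤ g → R f v → R g v) {N : ℕ} (hN : N ≠ 0)
    (h : ∀ v', Q v' → ∃ f b, ∀ v, b ≤ v → Q v → v ≡ v' [MOD N] → R f v) :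
    ∃ f b, ∀ v, b ≤ v → Q v → R f v := by
  have h1 : ∀ r, ∃ f b, ∀ v, b ≤ v → Q v → v % N = r → R f v := by
    intro r
    by_cases hr : ∃ v', Q v' ∧ v' % N = r
    · obtain ⟨v', hv', rfl⟩ := hr
      obtain ⟨f, b, hf⟩ := h v' hv'
      exact ⟨f, b, hf⟩
    · exact ⟨0, 0, fun v _ hv hvr => (hr ⟨v, hv, hvr⟩).elim⟩
  choose f b hf using h1
  refine ⟨(Finset.range N).sup f, (Finset.range N).sup b, fun v hv hQ => ?_⟩
  have hr : v % N ∈ Finset.range N := Finset.mem_range.2 (Nat.mod_lt _ (Nat.pos_of_ne_zero hN))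
  exact hR _ _ _ (Finset.le_sup hr) (hf _ v ((Finset.le_sup hr).trans hv) hQ rfl)

theorem exists_hasSmallFlats {K : Finset ℕ} (hK : K.Nonempty) (h2 : ∀ k ∈ K, 2 ≤ k) {d : ℕ}
    (hd : 0 < d) :
    ∃ f v₀, ∀ v, v₀ ≤ v → Admissible K v → HasSmallFlats (K : Set ℕ) d f v := by
  obtain ⟨k, hk⟩ := id hK
  have hkK : ({k} : Set ℕ) ⊆ (K : Set ℕ) := Set.singleton_subset_iff.2 (by simpa using hk)
  obtain ⟨M, u', hM0, hM⟩ := exists_gdd_singleton (h2 k hk)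
  set u := u' + 1
  replace hM : ∀ l, u ≤ l → GDD {k} M l := fun l hl => hM l (by omega)
  obtain ⟨q₁, u₁, hrow⟩ := exists_dec_Icc (m := 2 * u) (by omega)
  obtain ⟨P, hPq, hP⟩ := Nat.exists_infinite_primes q₁
  set c := (u + 1) * P + 3 + k with hc
  have hmono : ∀ f g v, f ≤ g → HasSmallFlats (K : Set ℕ) d f v →
    HasSmallFlats (K : Set ℕ) d g v := fun f g v hfg h => h.mono le_rfl hfg
  refine exists_uniform_of_modEq hmono hM0.ne' (fun v' hv' => ?_)
  obtain ⟨t, ht1, htmod, htdec⟩ := exists_dec_modEq hK h2 hv' hM0.ne' 1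
  obtain ⟨p, hp, htp, hpmod, hpdec⟩ := exists_prime_dec (h2 k hk)
    (mul_ne_zero hM0.ne' (pow_ne_zero c c.factorial_ne_zero)) t
  obtain ⟨a, ha⟩ := (Nat.modEq_iff_dvd' hp.one_le).1 hpmod.symm
  set T := t * (c.factorial ^ c * a) with hT
  have hMT : t * (p - 1) = M * T := by
    rw [ha, hT]
    ring
  have hMT0 : M * T ≠ 0 := by
    rw [← hMT]
    have := hp.two_le
    exact mul_ne_zero (by omega) (by omega)
  have hT0 : T ≠ 0 := right_ne_zero_of_mul hMT0
  have hUD : HasUD c T := HasUD.of_factorial_pow_dvd hT0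
    ((dvd_mul_right _ _).trans (dvd_mul_left _ _))
  have hN : ∀ l, u ≤ l → GDD (K : Set ℕ) (M * T) l := fun l hl => by
    refine (hM l hl).mul (fun k' hk' => ?_)
    rw [Set.mem_singleton_iff.1 hk']
    exact Dec.mono hkK (hUD.gdd (by omega))
  have hhole := Dec.incompleteGraph hp htp htdec (hpdec.mono hkK)
  rw [hMT] at hhole
  suffices h : ∃ f b, ∀ v, b ≤ v → (Admissible K v ∧ v ≡ v' [MOD M]) →
      HasSmallFlats (K : Set ℕ) d f v by
    obtain ⟨f, b, hf⟩ := h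
    exact ⟨f, b, fun v hb hv hmod => hf v hb ⟨hv, hmod⟩⟩
  refine exists_uniform_of_modEq hmono hMT0 (fun v'' hv'' => ?_)
  obtain ⟨v₁, hv₁t, hv₁mod, hv₁dec⟩ := exists_dec_modEq hK h2 hv''.1 hMT0 t
  obtain ⟨y, hy⟩ : M ∣ v₁ - t := (Nat.modEq_iff_dvd' hv₁t).1
    ((htmod.trans hv''.2.symm).trans (hv₁mod.of_dvd (dvd_mul_right _ _)).symm)
  obtain ⟨z, hzb, hz⟩ := Nat.exists_infinite_primes (c + (2 * u + 1) + y + u₁)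
  have hyz : y ≤ T * z := (show y ≤ z by omega).trans
    (Nat.le_mul_of_pos_left z (Nat.pos_of_ne_zero hT0))
  have hUDz : HasUD c (T * z) := by
    have := HasUD.prime_pow (c := c) (n := 1) hz (by rw [pow_one]; omega)
    rw [pow_one] at this
    exact hUD.mul this
  have hzW : z ≤ (u + 1) * z := Nat.le_mul_of_pos_left z (by omega)
  refine ⟨P ^ d * ((u + 1) * z * P) * (M * T) + (M * y + t), (u + 1) * z * (M * T) + v₁,
    fun v hv _ hmod => ?_⟩
  obtain ⟨U, hU⟩ : M * T ∣ v - v₁ := (Nat.modEq_iff_dvd' (by omega)).1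
    (hv₁mod.trans hmod.symm)
  have hUle : (u + 1) * z ≤ U := by
    refine Nat.le_of_mul_le_mul_right ?_ (Nat.pos_of_ne_zero hMT0)
    rw [mul_comm U]
    omega
  have hveq : v = U * (M * T) + (M * y + t) := by
    rw [mul_comm U]
    omega
  rw [hveq]
  refine hasSmallFlats_of_dec (u := u) hd (by omega) (by omega) hP ?_ hN ?_ hhole ?_ hUle
  · intro W hW
    exact (hrow W (by omega)).mono (Set.Icc_subset_Icc_right hPq)
  · intro W hW hW'
    refine dec_groupOf (fun l hl => Dec.mono hkK (hM l hl)) hN hUDz hyz (by omega) hW ?_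
    have : W / z ≤ (u + 1) * P := by
      refine Nat.div_le_of_le_mul (hW'.trans (le_of_eq ?_))
      ring
    omega
  · refine hv₁dec.top_congr ?_
    simp
    omega

theorem exists_finset_closure_le {α G : Type*} [AddGroup G] (f : α → G) (K : Set α) {x : G}
    (hx : x ∈ AddSubgroup.closure (f '' K)) :
    ∃ L : Finset α, (L : Set α) ⊆ K ∧ x ∈ AddSubgroup.closure (f '' L) := by
  classical
  induction hx using AddSubgroup.closure_induction with
  | mem x hx =>
    obtain ⟨k, hk, rfl⟩ := hx
    exact ⟨{k}, by simpa using hk, AddSubgroup.subset_closure ⟨k, by simp, rfl⟩⟩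
  | zero => exact ⟨∅, by simp, AddSubgroup.zero_mem _⟩
  | add x y _ _ hx hy =>
    obtain ⟨L, hL, hxL⟩ := hx
    obtain ⟨L', hL', hyL⟩ := hy
    refine ⟨L ∪ L', by simp [hL, hL'], AddSubgroup.add_mem _ ?_ ?_⟩
    · exact AddSubgroup.closure_mono (Set.image_mono (by simp)) hxL
    · exact AddSubgroup.closure_mono (Set.image_mono (by simp)) hyL
  | neg x _ hx =>
    obtain ⟨L, hL, hxL⟩ := hx
    exact ⟨L, hL, AddSubgroup.neg_mem _ hxL⟩

theorem exists_finset_admissible {K : Set ℕ} (hK : K.Nonempty) :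
    ∃ L : Finset ℕ, L.Nonempty ∧ (L : Set ℕ) ⊆ K ∧ ∀ v, Admissible K v → Admissible L v := by
  have key : ∀ f : ℕ → ℤ, ∃ L : Finset ℕ, (L : Set ℕ) ⊆ K ∧
      AddSubgroup.closure (f '' K) ≤ AddSubgroup.closure (f '' L) := by
    intro f
    obtain ⟨g, hg⟩ := Int.subgroup_cyclic (AddSubgroup.closure (f '' K))
    obtain ⟨L, hL, hgL⟩ := exists_finset_closure_le f K (x := g) (by
      rw [hg]
      exact AddSubgroup.subset_closure rfl)
    refine ⟨L, hL, ?_⟩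
    rw [hg, AddSubgroup.closure_le]
    simpa using hgL
  obtain ⟨k, hk⟩ := hK
  obtain ⟨L, hL, hL'⟩ := key fun k => (k : ℤ) - 1
  obtain ⟨L₂, hL₂, hL₂'⟩ := key fun k => (k : ℤ) * ((k : ℤ) - 1)
  classical
  refine ⟨insert k (L ∪ L₂), Finset.insert_nonempty _ _, ?_, fun v hv => ⟨?_, ?_⟩⟩
  · simp [Set.insert_subset_iff, hk, hL, hL₂]
  · exact AddSubgroup.closure_mono (Set.image_mono (fun x hx => by
      simp only [Finset.mem_coe] at hx
      simp [hx])) (hL' hv.1)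
  · exact AddSubgroup.closure_mono (Set.image_mono (fun x hx => by
      simp only [Finset.mem_coe] at hx
      simp [hx])) (hL₂' hv.2)

/-- For every set `K ⊆ {2,3,4,…}` of block sizes and every positive integer `d`, there are a
constant `f` (depending only on `d` and `K`) and a threshold `v₀` such that for every
admissible `v ≥ v₀` there is a `PBD(v,K)` in which every set of `d` points is contained
in a flat of size at most `f`. -/
theorem statement0 (K : Set ℕ) (hK : K ⊆ {n : ℕ | 2 ≤ n}) (d : ℕ) (hd : 0 < d) :
    ∃ f v₀ : ℕ, ∀ v : ℕ, v₀ ≤ v → Admissible K v →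
      ∃ Blocks : Finset (Finset (Fin v)), IsPBD Finset.univ K Blocks ∧
        ∀ S : Finset (Fin v), S.card = d →
          ∃ Y : Finset (Fin v), IsFlat Finset.univ Blocks Y ∧ S ⊆ Y ∧ Y.card ≤ f := by
  rcases K.eq_empty_or_nonempty with rfl | hne
  · refine ⟨0, 2, fun v hv hadm => ?_⟩
    have : (v : ℤ) - 1 = 0 := by simpa [SetGcdDvd] using hadm.1
    omega
  · obtain ⟨L, hL, hLK, hadm⟩ := exists_finset_admissible hne
    obtain ⟨f, v₀, hf⟩ := exists_hasSmallFlats hL (fun k hk => hK (hLK hk)) hd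
    exact ⟨f, v₀, fun v hv h => (hf v hv (hadm v h)).mono hLK le_rfl⟩
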